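/- arXiv:hep-th/9411141 — 3 statements merged into one kernel-verified Lean document; each statement's English description precedes it below -/
import Mathlib

section
/- Let n ≥ 1 and let T be a smooth function on J² satisfying (ADK′). Then T has the minor-polynomial form: there exist smooth coefficient functions T_{μ₁…μ_k;ν₁…ν_k} of (x^μ, ψ, ψ_μ) only (k = 0,…,n), completely antisymmetric in μ₁,…,μ_k, completely antisymmetric in ν₁,…,ν_k, and symmetric under the interchange (μ₁,…,μ_k) ↔ (ν₁,…,ν_k), such that T = Σ_{k=0}^{n} (1/(k!)²) T_{μ₁…μ_k;ν₁…ν_k} ψ^{μ₁…μ_k;ν₁…ν_k} (summation over all repeated indices). In particular T is a polynomial of degree ≤ n in the second-order variables ψ_{μν}. -/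
open scoped BigOperators

noncomputable section

/-- The first-order scalar jet space `(x, ψ, ψ_μ)` over `ℝ^n`. -/
abbrev J1 (n : ℕ) : Type := (Fin n → ℝ) × ℝ × (Fin n → ℝ)

/-- The second-order scalar jet space `(x, ψ, ψ_μ, ψ_{μν})` over `ℝ^n`, with the
second-order variable represented by a full (not a priori symmetric) matrix. -/
abbrev J2 (n : ℕ) : Type := (Fin n → ℝ) × ℝ × (Fin n → ℝ) × (Fin n → Fin n → ℝ)

/-- The fourth-order scalar jet space `(x, ψ, ψ_μ, ψ_{μν}, ψ_{μνρ}, ψ_{μνρσ})`. -/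
abbrev J4 (n : ℕ) : Type :=
  (Fin n → ℝ) × ℝ × (Fin n → ℝ) × (Fin n → Fin n → ℝ) ×
    ((Fin 3 → Fin n) → ℝ) × ((Fin 4 → Fin n) → ℝ)

/-- Symmetrization of a matrix. -/
def symmM {n : ℕ} (q : Fin n → Fin n → ℝ) : Fin n → Fin n → ℝ :=
  fun i j => (q i j + q j i) / 2

/-- `T` depends only on the symmetric part of the second-order variable, i.e. `T` is the
canonical extension `T̃(q) = T((q+qᵀ)/2)` of a function of the symmetric coordinates `ψ_{μν}`. -/
def SymmDep {n : ℕ} (T : J2 n → ℝ) : Prop :=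
  ∀ x ψ p q, T (x, ψ, p, q) = T (x, ψ, p, symmM q)

/-- The symmetrized elementary matrix `(E_{μν} + E_{νμ})/2`, the direction computing the
normalized derivative `∂^{μν}`. -/
def symE {n : ℕ} (μ ν : Fin n) : Fin n → Fin n → ℝ := fun i j =>
  ((if i = μ ∧ j = ν then (1 : ℝ) else 0) + (if i = ν ∧ j = μ then (1 : ℝ) else 0)) / 2

/-- The symmetrized elementary tensor of order `l` attached to a tuple `μ`, the direction
computing the normalized derivative `∂^{μ₁...μ_l} = (r₁!⋯r_n!/l!) ∂/∂ψ_{{μ₁...μ_l}}`. -/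
def symT {n l : ℕ} (μ : Fin l → Fin n) : (Fin l → Fin n) → ℝ := fun i =>
  (∑ σ : Equiv.Perm (Fin l), if i = μ ∘ σ then (1 : ℝ) else 0) / (l.factorial : ℝ)

/-- `∂T := ∂T/∂ψ` on `J²`. -/
def pdPsi {n : ℕ} (T : J2 n → ℝ) : J2 n → ℝ := fun z => fderiv ℝ T z (0, 1, 0, 0)

/-- `∂T/∂x^μ` on `J²`. -/
def pdX {n : ℕ} (T : J2 n → ℝ) (μ : Fin n) : J2 n → ℝ := fun z =>
  fderiv ℝ T z (Pi.single μ 1, 0, 0, 0)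

/-- `∂^μ T := ∂T/∂ψ_μ` on `J²`. -/
def pd1 {n : ℕ} (T : J2 n → ℝ) (μ : Fin n) : J2 n → ℝ := fun z =>
  fderiv ℝ T z (0, 0, Pi.single μ 1, 0)

/-- The normalized second-order derivative `∂^{μν} T` on `J²`. -/
def pd2 {n : ℕ} (T : J2 n → ℝ) (μ ν : Fin n) : J2 n → ℝ := fun z =>
  fderiv ℝ T z (0, 0, 0, symE μ ν)

/-- The equations (ADK′):
`∂^{μρ₁}∂^{ρ₂ρ₃}T + ∂^{μρ₂}∂^{ρ₃ρ₁}T + ∂^{μρ₃}∂^{ρ₁ρ₂}T = 0`. -/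
def ADKfirst {n : ℕ} (T : J2 n → ℝ) : Prop :=
  ∀ μ ρ₁ ρ₂ ρ₃ : Fin n, ∀ z : J2 n,
    pd2 (pd2 T ρ₂ ρ₃) μ ρ₁ z + pd2 (pd2 T ρ₃ ρ₁) μ ρ₂ z + pd2 (pd2 T ρ₁ ρ₂) μ ρ₃ z = 0

/-- The truncated total derivative `D̃_μ := ∂/∂x^μ + ψ_μ ∂ + Σ_ν ψ_{μν} ∂^ν` acting on
functions on `J²`. -/
def Dt {n : ℕ} (μ : Fin n) (T : J2 n → ℝ) : J2 n → ℝ := fun z =>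
  pdX T μ z + z.2.2.1 μ * pdPsi T z + ∑ ν, z.2.2.2 μ ν * pd1 T ν z

/-- The equations (ADK″): `∂^μ T = Σ_ν (∂/∂x^ν + ψ_ν ∂ + Σ_ρ ψ_{νρ} ∂^ρ) ∂^{μν} T`. -/
def ADKsecond {n : ℕ} (T : J2 n → ℝ) : Prop :=
  ∀ μ : Fin n, ∀ z : J2 n, pd1 T μ z = ∑ ν, Dt ν (pd2 T μ ν) z

open Classical in
/-- The Levi–Civita symbol `ε^{μ₁...μ_n}`. -/
def lc {n : ℕ} (μ : Fin n → Fin n) : ℝ :=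
  if h : Function.Bijective μ then ((Equiv.Perm.sign (Equiv.ofBijective μ h) : ℤ) : ℝ) else 0

/-- The minor `ψ^{μ₁...μ_k;ν₁...ν_k} := (1/(n−k)!) Σ ε^{μ₁...μ_n} ε^{ν₁...ν_n}
ψ_{μ_{k+1}ν_{k+1}} ⋯ ψ_{μ_nν_n}` of the matrix `q`. -/
def minorP {n : ℕ} (k : ℕ) (μ ν : Fin k → Fin n) (q : Fin n → Fin n → ℝ) : ℝ :=
  if h : k + (n - k) = n then
    ((n - k).factorial : ℝ)⁻¹ *
      ∑ a : Fin (n - k) → Fin n, ∑ b : Fin (n - k) → Fin n,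
        lc (Fin.append μ a ∘ Fin.cast h.symm) * lc (Fin.append ν b ∘ Fin.cast h.symm) *
          ∏ i, q (a i) (b i)
  else 0

/-- The coefficients of a minor-polynomial representation: smooth functions of `(x, ψ, ψ_μ)`
only, completely antisymmetric in the `μ`'s, completely antisymmetric in the `ν`'s, and
symmetric under the interchange of the two index groups. -/
def MinorCoeffOK {n : ℕ}
    (c : (k : ℕ) → (Fin k → Fin n) → (Fin k → Fin n) → J1 n → ℝ) : Prop :=
  (∀ k (μ ν : Fin k → Fin n), ContDiff ℝ (⊤ : ℕ∞) (c k μ ν)) ∧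
  (∀ k (μ ν : Fin k → Fin n) (σ : Equiv.Perm (Fin k)) (w : J1 n),
      c k (μ ∘ σ) ν w = ((Equiv.Perm.sign σ : ℤ) : ℝ) * c k μ ν w) ∧
  (∀ k (μ ν : Fin k → Fin n) (σ : Equiv.Perm (Fin k)) (w : J1 n),
      c k μ (ν ∘ σ) w = ((Equiv.Perm.sign σ : ℤ) : ℝ) * c k μ ν w) ∧
  (∀ k (μ ν : Fin k → Fin n) (w : J1 n), c k ν μ w = c k μ ν w)

/-- `T = Σ_{k=0}^{n} (1/(k!)²) T_{μ₁…μ_k;ν₁…ν_k} ψ^{μ₁…μ_k;ν₁…ν_k}` (sum over all repeated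
indices), evaluated on the symmetric part of the second-order variable. -/
def MinorRep {n : ℕ} (T : J2 n → ℝ)
    (c : (k : ℕ) → (Fin k → Fin n) → (Fin k → Fin n) → J1 n → ℝ) : Prop :=
  ∀ x ψ p q, T (x, ψ, p, q) =
    ∑ k ∈ Finset.range (n + 1), ((k.factorial : ℝ)⁻¹) ^ 2 *
      ∑ μ : Fin k → Fin n, ∑ ν : Fin k → Fin n,
        c k μ ν (x, ψ, p) * minorP k μ ν (symmM q)

/-- `T` has the minor-polynomial form of Theorem 2. -/
def MinorPolyForm {n : ℕ} (T : J2 n → ℝ) : Prop :=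
  ∃ c, MinorCoeffOK c ∧ MinorRep T c

/-! ### Fourth-order machinery -/

/-- The canonical projection `π : J⁴ → J²`. -/
def proj24 {n : ℕ} (z : J4 n) : J2 n := (z.1, z.2.1, z.2.2.1, z.2.2.2.1)

def pdPsi4 {n : ℕ} (f : J4 n → ℝ) : J4 n → ℝ := fun z => fderiv ℝ f z (0, 1, 0, 0, 0, 0)

def pdX4 {n : ℕ} (f : J4 n → ℝ) (μ : Fin n) : J4 n → ℝ := fun z =>
  fderiv ℝ f z (Pi.single μ 1, 0, 0, 0, 0, 0)

def pd14 {n : ℕ} (f : J4 n → ℝ) (μ : Fin n) : J4 n → ℝ := fun z =>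
  fderiv ℝ f z (0, 0, Pi.single μ 1, 0, 0, 0)

def pd24 {n : ℕ} (f : J4 n → ℝ) (μ ν : Fin n) : J4 n → ℝ := fun z =>
  fderiv ℝ f z (0, 0, 0, symE μ ν, 0, 0)

/-- The normalized third-order derivative `∂^{μνρ}` on `J⁴`. -/
def pd34 {n : ℕ} (f : J4 n → ℝ) (μ ν ρ : Fin n) : J4 n → ℝ := fun z =>
  fderiv ℝ f z (0, 0, 0, 0, symT ![μ, ν, ρ], 0)

/-- The total derivative
`D_μ f = ∂f/∂x^μ + ψ_μ ∂f + ψ_{μν} ∂^ν f + ψ_{μνρ} ∂^{νρ} f + ψ_{μνρσ} ∂^{νρσ} f`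
(summation over repeated indices) on `J⁴`. -/
def Dtot {n : ℕ} (μ : Fin n) (f : J4 n → ℝ) : J4 n → ℝ := fun z =>
  pdX4 f μ z + z.2.2.1 μ * pdPsi4 f z + (∑ ν, z.2.2.2.1 μ ν * pd14 f ν z) +
    (∑ ν, ∑ ρ, z.2.2.2.2.1 ![μ, ν, ρ] * pd24 f ν ρ z) +
    (∑ ν, ∑ ρ, ∑ σ, z.2.2.2.2.2 ![μ, ν, ρ, σ] * pd34 f ν ρ σ z)

/-- The Euler–Lagrange expression `E(L) := ∂L − D_μ(∂^μ L) + D_μ D_ν (∂^{μν} L)` of a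
second-order Lagrangian, a function on `J⁴`. -/
def EL {n : ℕ} (L : J2 n → ℝ) : J4 n → ℝ := fun z =>
  pdPsi L (proj24 z) - (∑ μ, Dtot μ (fun w => pd1 L μ (proj24 w)) z) +
    ∑ μ, ∑ ν, Dtot μ (Dtot ν (fun w => pd2 L μ ν (proj24 w))) z

/-- The reduced second-order Euler–Lagrange expression
`∂L − D̃_μ(∂^μL) + D̃_{μ₁}D̃_{μ₂}(∂^{μ₁μ₂}L)`, a function on `J²`. -/
def EL2 {n : ℕ} (L : J2 n → ℝ) : J2 n → ℝ := fun z =>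
  pdPsi L z - (∑ μ, Dt μ (pd1 L μ) z) + ∑ μ, ∑ ν, Dt μ (Dt ν (pd2 L μ ν)) z

/-- The Tonti Lagrangian `L = ∫₀¹ ψ T(x, λψ, λψ_μ, λψ_{μν}) dλ`. -/
def Tonti {n : ℕ} (T : J2 n → ℝ) : J2 n → ℝ := fun z =>
  ∫ lam in (0 : ℝ)..1, z.2.1 * T (z.1, lam * z.2.1, lam • z.2.2.1, lam • z.2.2.2)

/-! ### First-order derivative operators -/

def pdX1 {n : ℕ} (f : J1 n → ℝ) (μ : Fin n) : J1 n → ℝ := fun w =>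
  fderiv ℝ f w (Pi.single μ 1, 0, 0)

def pdPsi1 {n : ℕ} (f : J1 n → ℝ) : J1 n → ℝ := fun w => fderiv ℝ f w (0, 1, 0)

def pd11 {n : ℕ} (f : J1 n → ℝ) (μ : Fin n) : J1 n → ℝ := fun w =>
  fderiv ℝ f w (0, 0, Pi.single μ 1)

/-- `δ/δx^μ := ∂/∂x^μ + ψ_μ ∂` on functions of `(x, ψ, ψ_μ)`. -/
def dX1var {n : ℕ} (f : J1 n → ℝ) (μ : Fin n) : J1 n → ℝ := fun w =>
  pdX1 f μ w + w.2.2 μ * pdPsi1 f w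

/-! ### Minkowski structures -/

/-- The Minkowski metric `G = diag(1, −1, …, −1)` on `ℝ^n`. -/
def MinkG (n : ℕ) : Fin n → Fin n → ℝ := fun i j =>
  if i = j then (if (i : ℕ) = 0 then 1 else -1) else 0

/-- The proper orthochronous Lorentz group. -/
def IsLorentz {n : ℕ} (L : Fin n → Fin n → ℝ) : Prop :=
  (∀ i j, ∑ ρ, ∑ σ, L ρ i * MinkG n ρ σ * L σ j = MinkG n i j) ∧
    Matrix.det (Matrix.of L) = 1 ∧ ∀ h : 0 < n, 1 ≤ L ⟨0, h⟩ ⟨0, h⟩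

/-- The (lifted) action of the Poincaré group on `J²`:
`φ̇_{L,a}(x,ψ,ψ_μ,ψ_{μν}) = (Lx+a, ψ, L_μ^ρ ψ_ρ, L_μ^ρ L_ν^σ ψ_{ρσ})`. -/
def pact {n : ℕ} (L : Fin n → Fin n → ℝ) (a : Fin n → ℝ) (z : J2 n) : J2 n :=
  (fun μ => (∑ ν, L μ ν * z.1 ν) + a μ, z.2.1,
   fun μ => ∑ ρ, L μ ρ * z.2.2.1 ρ,
   fun μ ν => ∑ ρ, ∑ σ, L μ ρ * L ν σ * z.2.2.2 ρ σ)

/-- The Lorentz invariant `J = G^{μν} ψ_μ ψ_ν`. -/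
def MinkJ {n : ℕ} (p : Fin n → ℝ) : ℝ := ∑ μ, ∑ ν, MinkG n μ ν * p μ * p ν

/-- The Lorentz invariant `I_k := (Π_{i=1}^k G_{μ_iν_i}) ψ^{μ₁…μ_k;ν₁…ν_k}`. -/
def Ik {n : ℕ} (k : ℕ) (q : Fin n → Fin n → ℝ) : ℝ :=
  ∑ μ : Fin k → Fin n, ∑ ν : Fin k → Fin n,
    (∏ i, MinkG n (μ i) (ν i)) * minorP k μ ν q

/-- The Lorentz invariant `J_k := ψ_{μ₁}ψ_{ν₁} (Π_{i=2}^k G_{μ_iν_i}) ψ^{μ₁…μ_k;ν₁…ν_k}`. -/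
def Jk {n : ℕ} (k : ℕ) (p : Fin n → ℝ) (q : Fin n → Fin n → ℝ) : ℝ :=
  if h : 0 < k then
    ∑ μ : Fin k → Fin n, ∑ ν : Fin k → Fin n,
      p (μ ⟨0, h⟩) * p (ν ⟨0, h⟩) *
        (∏ i ∈ Finset.univ.erase (⟨0, h⟩ : Fin k), MinkG n (μ i) (ν i)) * minorP k μ ν q
  else 0

/-- Derivative with respect to the first variable `ψ` of a function of `(ψ, J)`. -/
def d1 (F : ℝ × ℝ → ℝ) : ℝ × ℝ → ℝ := fun w => fderiv ℝ F w (1, 0)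

/-- Derivative with respect to the second variable `J` of a function of `(ψ, J)`. -/
def d2 (F : ℝ × ℝ → ℝ) : ℝ × ℝ → ℝ := fun w => fderiv ℝ F w (0, 1)

/-- The Poincaré-invariant normal form
`T = A₀ det(ψ_{μν}) + Σ_{k=1}^{n−1} (A_k I_k + B_k J_k) + A_n`. -/
def PoincT (n : ℕ) (A B : ℕ → ℝ × ℝ → ℝ) : J2 n → ℝ := fun z =>
  A 0 (z.2.1, MinkJ z.2.2.1) * Matrix.det (Matrix.of (symmM z.2.2.2)) +
    (∑ k ∈ Finset.Icc 1 (n - 1),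
      (A k (z.2.1, MinkJ z.2.2.1) * Ik k (symmM z.2.2.2) +
        B k (z.2.1, MinkJ z.2.2.1) * Jk k z.2.2.1 (symmM z.2.2.2))) +
    A n (z.2.1, MinkJ z.2.2.1)

/-- Equation (einv1): `∂A_{k−1}/∂ψ − 2k ∂A_k/∂J − 2J ∂B_k/∂J − (n+k) B_k = 0`
for `k = 1, …, n−1`. -/
def Einv1 (n : ℕ) (A B : ℕ → ℝ × ℝ → ℝ) : Prop :=
  ∀ m : ℕ, m + 1 ≤ n - 1 → ∀ w : ℝ × ℝ,
    d1 (A m) w - 2 * ((m : ℝ) + 1) * d2 (A (m + 1)) w - 2 * w.2 * d2 (B (m + 1)) w -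
      ((n : ℝ) + ((m : ℝ) + 1)) * B (m + 1) w = 0

/-- Equation (einv2): `∂B_k/∂ψ = 0` for `k = 1, …, n−2`. -/
def Einv2 (n : ℕ) (B : ℕ → ℝ × ℝ → ℝ) : Prop :=
  ∀ m : ℕ, m + 1 ≤ n - 2 → ∀ w : ℝ × ℝ, d1 (B (m + 1)) w = 0

/-- Equation (einv3): `2 ∂A_n/∂J + (n−1)! ∂A_{n−1}/∂ψ = 0`. -/
def Einv3 (n : ℕ) (A : ℕ → ℝ × ℝ → ℝ) : Prop :=
  ∀ w : ℝ × ℝ, 2 * d2 (A n) w + ((n - 1).factorial : ℝ) * d1 (A (n - 1)) w = 0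


/-! ### Iterated directional derivatives in the second-order variables -/

/-- Iterated directional derivatives of `T` along a list of matrices. -/
def dirD {n : ℕ} (T : J2 n → ℝ) : List (Fin n → Fin n → ℝ) → J2 n → ℝ
  | [] => T
  | Q :: L => fun z => fderiv ℝ (dirD T L) z (0, 0, 0, Q)

theorem dirD_contDiff {n : ℕ} {T : J2 n → ℝ} (hT : ContDiff ℝ (⊤ : ℕ∞) T)
    (L : List (Fin n → Fin n → ℝ)) : ContDiff ℝ (⊤ : ℕ∞) (dirD T L) := by
  induction L with
  | nil => exact hT
  | cons Q L ih =>
    have h : ContDiff ℝ (⊤ : ℕ∞) (fderiv ℝ (dirD T L)) := ih.fderiv_right (by simp)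
    exact h.clm_apply contDiff_const

theorem dir_comm {n : ℕ} {f : J2 n → ℝ} (hf : ContDiff ℝ (⊤ : ℕ∞) f) (u v z : J2 n) :
    fderiv ℝ (fun y => fderiv ℝ f y u) z v = fderiv ℝ (fun y => fderiv ℝ f y v) z u := by
  have h : ContDiff ℝ (⊤ : ℕ∞) (fderiv ℝ f) := hf.fderiv_right (by simp)
  have hd : DifferentiableAt ℝ (fderiv ℝ f) z := h.differentiable (by simp) z
  have hs : IsSymmSndFDerivAt ℝ f z :=
    (hf.contDiffAt).isSymmSndFDerivAt (by simpa using WithTop.coe_le_coe.2 (le_top : (2 : ℕ∞) ≤ ⊤))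
  rw [fderiv_clm_apply hd (by fun_prop), fderiv_clm_apply hd (by fun_prop)]
  simpa using hs v u

theorem dirD_perm {n : ℕ} {T : J2 n → ℝ} (hT : ContDiff ℝ (⊤ : ℕ∞) T)
    {L L' : List (Fin n → Fin n → ℝ)} (h : L.Perm L') : dirD T L = dirD T L' := by
  induction h with
  | nil => rfl
  | cons Q _ ih => simp only [dirD, ih]
  | swap Q Q' L =>
    funext z
    exact dir_comm (dirD_contDiff hT L) _ _ z
  | trans _ _ h1 h2 => exact h1.trans h2

theorem ADK_dirD {n : ℕ} {T : J2 n → ℝ} (hT : ContDiff ℝ (⊤ : ℕ∞) T) (hADK : ADKfirst T)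
    (L : List (Fin n → Fin n → ℝ)) (μ ρ₁ ρ₂ ρ₃ : Fin n) (z : J2 n) :
    dirD T (symE μ ρ₁ :: symE ρ₂ ρ₃ :: L) z + dirD T (symE μ ρ₂ :: symE ρ₃ ρ₁ :: L) z
      + dirD T (symE μ ρ₃ :: symE ρ₁ ρ₂ :: L) z = 0 := by
  induction L generalizing z with
  | nil => exact hADK μ ρ₁ ρ₂ ρ₃ z
  | cons Q L ih =>
    have key : ∀ A B : Fin n → Fin n → ℝ,
        dirD T (A :: B :: Q :: L) = dirD T (Q :: A :: B :: L) := by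
      intro A B
      apply dirD_perm hT
      exact ((List.Perm.swap Q B L).cons A).trans (List.Perm.swap Q A _)
    rw [key, key, key]
    have hd : ∀ A B : Fin n → Fin n → ℝ,
        DifferentiableAt ℝ (dirD T (A :: B :: L)) z := fun A B =>
      (dirD_contDiff hT _).differentiable (by simp) z
    have h0 : (fun y => dirD T (symE μ ρ₁ :: symE ρ₂ ρ₃ :: L) y
        + dirD T (symE μ ρ₂ :: symE ρ₃ ρ₁ :: L) y
        + dirD T (symE μ ρ₃ :: symE ρ₁ ρ₂ :: L) y) = fun _ => 0 := funext ih
    have h1 := congrArg (fun g => fderiv ℝ g z (0, 0, 0, Q)) h0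
    rw [fderiv_fun_add ((hd _ _).fun_add (hd _ _)) (hd _ _), fderiv_fun_add (hd _ _) (hd _ _)] at h1
    simpa [dirD] using h1

theorem symE_comm {n : ℕ} (μ ν : Fin n) : symE μ ν = symE ν μ := by
  funext i j
  simp only [symE]
  rw [add_comm]

theorem sym_decomp {n : ℕ} (q : Fin n → Fin n → ℝ) (hq : ∀ i j, q i j = q j i) :
    q = ∑ x : Fin n × Fin n, q x.1 x.2 • symE x.1 x.2 := by
  funext i j
  have h1 : ∀ x : Fin n × Fin n, q x.1 x.2 * symE x.1 x.2 i j
      = ((if x = (i, j) then q x.1 x.2 else 0) + (if x = (j, i) then q x.1 x.2 else 0)) / 2 := by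
    rintro ⟨a, b⟩
    simp only [symE, Prod.mk.injEq]
    have e1 : (i = a ∧ j = b) = (a = i ∧ b = j) := by rw [eq_comm (a := i), eq_comm (a := j)]
    have e2 : (i = b ∧ j = a) = (a = j ∧ b = i) := by
      rw [eq_comm (a := i), eq_comm (a := j), and_comm]
    simp only [e1, e2]
    split_ifs <;> ring
  simp only [Finset.sum_apply, Pi.smul_apply, smul_eq_mul, h1]
  rw [← Finset.sum_div, Finset.sum_add_distrib]
  simp [hq j i]

theorem dirD_lin {n : ℕ} (T : J2 n → ℝ) (L : List (Fin n → Fin n → ℝ))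
    (q : Fin n → Fin n → ℝ) (hq : ∀ i j, q i j = q j i) (z : J2 n) :
    dirD T (q :: L) z = ∑ x : Fin n × Fin n, q x.1 x.2 * dirD T (symE x.1 x.2 :: L) z := by
  let ι : (Fin n → Fin n → ℝ) →ₗ[ℝ] J2 n :=
    LinearMap.inr ℝ _ _ ∘ₗ LinearMap.inr ℝ _ _ ∘ₗ LinearMap.inr ℝ _ _
  have hι : ∀ Q, ι Q = ((0, 0, 0, Q) : J2 n) := fun Q => rfl
  simp only [dirD, ← hι]
  conv_lhs => rw [sym_decomp q hq]
  simp [map_sum, map_smul]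

theorem dirD_replicate {n : ℕ} {T : J2 n → ℝ} (hT : ContDiff ℝ (⊤ : ℕ∞) T)
    (q : Fin n → Fin n → ℝ) (hq : ∀ i j, q i j = q j i) (m : ℕ) (z : J2 n) :
    dirD T (List.replicate m q) z = ∑ p : Fin m → Fin n × Fin n,
      (∏ l, q (p l).1 (p l).2) * dirD T (List.ofFn fun l => symE (p l).1 (p l).2) z := by
  induction m generalizing z with
  | zero => simp
  | succ m ih =>
    rw [List.replicate_succ, dirD_lin T _ q hq]
    conv_rhs => rw [← Equiv.sum_comp (Fin.consEquiv (fun _ : Fin (m + 1) => Fin n × Fin n)), Fintype.sum_prod_type]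
    refine Finset.sum_congr rfl fun x _ => ?_
    have h0 : dirD T (List.replicate m q) = fun z => ∑ p : Fin m → Fin n × Fin n,
      (∏ l, q (p l).1 (p l).2) * dirD T (List.ofFn fun l => symE (p l).1 (p l).2) z := funext ih
    have hd : ∀ p : Fin m → Fin n × Fin n,
        DifferentiableAt ℝ (dirD T (List.ofFn fun l => symE (p l).1 (p l).2)) z := fun p =>
      (dirD_contDiff hT _).differentiable (by simp) z
    simp only [dirD]
    rw [h0, fderiv_fun_sum (fun p _ => (hd p).const_mul _), sum_apply,
      Finset.mul_sum]
    refine Finset.sum_congr rfl fun p _ => ?_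
    rw [fderiv_const_mul (hd p)]
    simp [Fin.consEquiv, Fin.prod_univ_succ, List.ofFn_succ, dirD, mul_assoc]

theorem taylor_poly (N : ℕ) : ∀ (g : ℕ → ℝ → ℝ),
    (∀ m t, HasDerivAt (g m) (g (m + 1) t) t) → (∀ t, g N t = 0) →
    ∀ t, g 0 t = ∑ m ∈ Finset.range N, g m 0 * (t ^ m / (m.factorial : ℝ)) := by
  induction N with
  | zero => intro g _ h t; simpa using h t
  | succ N ih =>
    intro g hg h t
    have h1 := ih (fun m => g (m + 1)) (fun m t => hg (m + 1) t) h
    simp only [zero_add] at h1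
    have h2 : ∀ t, HasDerivAt (fun t => g 0 t -
        ∑ m ∈ Finset.range (N + 1), g m 0 * (t ^ m / (m.factorial : ℝ))) 0 t := by
      intro t
      have h3 : HasDerivAt (fun t : ℝ =>
          ∑ m ∈ Finset.range (N + 1), g m 0 * (t ^ m / (m.factorial : ℝ)))
          (∑ m ∈ Finset.range (N + 1), g m 0 * ((m * t ^ (m - 1)) / (m.factorial : ℝ))) t := by
        apply HasDerivAt.fun_sum
        intro m _
        exact ((hasDerivAt_pow m t).div_const _).const_mul _
      have h4 := (hg 0 t).sub h3
      refine h4.congr_deriv ?_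
      rw [zero_add, h1 t, Finset.sum_range_succ', sub_eq_zero, eq_comm]
      simp only [Nat.cast_zero, zero_mul, zero_div, mul_zero, add_zero]
      refine Finset.sum_congr rfl fun m _ => ?_
      have : ((m.factorial : ℝ)) ≠ 0 := by positivity
      rw [Nat.factorial_succ]
      push_cast
      field_simp
    have h5 := is_const_of_deriv_eq_zero (fun t => (h2 t).differentiableAt)
      (fun t => (h2 t).deriv) t 0
    have h6 : ∑ m ∈ Finset.range (N + 1), g m 0 * ((0 : ℝ) ^ m / (m.factorial : ℝ)) = g 0 0 := by
      rw [Finset.sum_range_succ']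
      simp
    rw [h6, sub_self] at h5
    linarith

theorem dirD_hasDerivAt {n : ℕ} {T : J2 n → ℝ} (hT : ContDiff ℝ (⊤ : ℕ∞) T)
    (q : Fin n → Fin n → ℝ) (x : Fin n → ℝ) (ψ : ℝ) (p : Fin n → ℝ) (m : ℕ) (t : ℝ) :
    HasDerivAt (fun t : ℝ => dirD T (List.replicate m q) (x, ψ, p, t • q))
      (dirD T (List.replicate (m + 1) q) (x, ψ, p, t • q)) t := by
  have h1 : HasDerivAt (fun t : ℝ => ((x, ψ, p, t • q) : J2 n)) (0, 0, 0, q) t := by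
    refine (hasDerivAt_const t x).prodMk ((hasDerivAt_const t ψ).prodMk
      ((hasDerivAt_const t p).prodMk ?_))
    simpa using (hasDerivAt_id t).smul_const q
  have h2 := ((dirD_contDiff hT (List.replicate m q)).differentiable (by simp)
    (x, ψ, p, t • q)).hasFDerivAt
  exact h2.comp_hasDerivAt t h1

/-! ### The combinatorial core -/

/-- Abstract form of (ADK′) for a function of `m` index pairs. -/
def GCond {n m : ℕ} (G : (Fin m → Fin n × Fin n) → ℝ) : Prop :=
  ∀ (i k : Fin m), i ≠ k → ∀ (μ ρ₁ ρ₂ ρ₃ : Fin n) (P₁ P₂ P₃ : Fin m → Fin n × Fin n),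
    (∀ l, l ≠ i → l ≠ k → P₁ l = P₃ l ∧ P₂ l = P₃ l) →
    P₁ i = (ρ₁, μ) → P₁ k = (ρ₃, ρ₂) → P₂ i = (ρ₂, μ) → P₂ k = (ρ₃, ρ₁) →
    P₃ i = (ρ₁, ρ₂) → P₃ k = (ρ₃, μ) → G P₁ + G P₂ + G P₃ = 0

/-- Contraction of `G`, twisted by a permutation, with `q ⊗ ⋯ ⊗ q`. -/
def SS {n m : ℕ} (G : (Fin m → Fin n × Fin n) → ℝ) (q : Fin n → Fin n → ℝ)
    (σ : Equiv.Perm (Fin m)) : ℝ :=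
  ∑ p : Fin m → Fin n × Fin n, (∏ l, q (p l).1 (p l).2) * G fun l => ((p l).1, (p (σ l)).2)

theorem SS_step {n m : ℕ} (G : (Fin m → Fin n × Fin n) → ℝ) (hG : GCond G)
    (q : Fin n → Fin n → ℝ) (hq : ∀ i j, q i j = q j i)
    (σ : Equiv.Perm (Fin m)) (i : Fin m) (hi : σ i ≠ i) :
    SS G q (Equiv.swap i (σ i) * σ) = -2 * SS G q σ := by
  have hinv : Function.Involutive (fun p : Fin m → Fin n × Fin n =>
      Function.update p i (p i).swap) := by
    intro p
    simp
  have h2 : SS G q σ = ∑ p : Fin m → Fin n × Fin n, (∏ l, q (p l).1 (p l).2) *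
      G fun l => ((Function.update p i (p i).swap l).1,
        (Function.update p i (p i).swap (σ l)).2) := by
    unfold SS
    rw [← Equiv.sum_comp hinv.toPerm]
    refine Finset.sum_congr rfl fun p _ => ?_
    congr 1
    refine Finset.prod_congr rfl fun l _ => ?_
    simp only [Function.Involutive.coe_toPerm]
    by_cases hl : l = i
    · subst hl; simp [hq]
    · simp [hl]
  have h3 : SS G q σ + SS G q σ + SS G q (Equiv.swap i (σ i) * σ) = 0 := by
    conv_lhs => rw [h2]
    conv_lhs => enter [1, 1]; rw [← h2]
    unfold SS
    rw [← Finset.sum_add_distrib, ← Finset.sum_add_distrib]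
    refine Finset.sum_eq_zero fun p _ => ?_
    rw [← mul_add, ← mul_add]
    apply mul_eq_zero_of_right
    have hk : σ.symm i ≠ i := fun h => hi (by rw [← h]; simpa using h.symm)
    apply hG i (σ.symm i) hk.symm (p (σ i)).2 (p i).1 (p i).2 (p (σ.symm i)).1
    · intro l h1 h2
      have h4 : σ l ≠ i := fun h => h2 (by rw [← h]; simp)
      have h5 : σ l ≠ σ i := fun h => h1 (σ.injective h)
      simp [h1, h4, Equiv.swap_apply_of_ne_of_ne h4 h5]
    · simp
    · simp
    · simp [hi]
    · simp [hk]
    · simp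
    · simp
  linarith

theorem SS_sign (m : ℕ) (N : ℕ) : ∀ (σ : Equiv.Perm (Fin m)), σ.support.card = N →
    ∃ d : ℝ, 0 < d ∧ ∀ (n : ℕ) (G : (Fin m → Fin n × Fin n) → ℝ) (_ : GCond G)
      (q : Fin n → Fin n → ℝ) (_ : ∀ i j, q i j = q j i),
      ((Equiv.Perm.sign σ : ℤ) : ℝ) * SS G q σ = d * SS G q 1 := by
  induction N using Nat.strong_induction_on with
  | _ N ih =>
    intro σ hσ
    by_cases h1 : σ = 1
    · refine ⟨1, one_pos, ?_⟩
      intros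
      simp [h1]
    · obtain ⟨i, hi⟩ : ∃ i, σ i ≠ i := by
        by_contra! h
        exact h1 (Equiv.ext h)
      obtain ⟨d, hd, h⟩ := ih _ (hσ ▸ Equiv.Perm.card_support_swap_mul hi)
        (Equiv.swap i (σ i) * σ) rfl
      refine ⟨d / 2, by positivity, ?_⟩
      intro n G hG q hq
      have h3 := h n G hG q hq
      rw [SS_step G hG q hq σ i hi, Equiv.Perm.sign_mul, Equiv.Perm.sign_swap (Ne.symm hi)] at h3
      push_cast at h3
      linarith

theorem SS_sum (m : ℕ) : ∃ D : ℝ, 0 < D ∧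
    ∀ (n : ℕ) (G : (Fin m → Fin n × Fin n) → ℝ) (_ : GCond G)
      (q : Fin n → Fin n → ℝ) (_ : ∀ i j, q i j = q j i),
      ∑ a : Fin m → Fin n, ∑ b : Fin m → Fin n,
        G (fun l => (a l, b l)) * Matrix.det (Matrix.of fun i j => q (a i) (b j))
        = D * ∑ p : Fin m → Fin n × Fin n, (∏ l, q (p l).1 (p l).2) * G p := by
  choose d hd hd' using fun σ : Equiv.Perm (Fin m) => SS_sign m _ σ rfl
  refine ⟨∑ σ, d σ, Finset.sum_pos (fun σ _ => hd σ) ⟨1, Finset.mem_univ _⟩, ?_⟩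
  intro n G hG q hq
  have h1 : SS G q 1 = ∑ p : Fin m → Fin n × Fin n, (∏ l, q (p l).1 (p l).2) * G p := rfl
  rw [← h1, Finset.sum_mul]
  simp_rw [← hd' _ n G hG q hq]
  have h2 : ∀ σ : Equiv.Perm (Fin m), SS G q σ = ∑ a : Fin m → Fin n, ∑ b : Fin m → Fin n,
      G (fun l => (a l, b l)) * ∏ l, q (a (σ l)) (b l) := by
    intro σ
    unfold SS
    refine (Fintype.sum_equiv
      (Equiv.arrowProdEquivProdArrow (Fin m) (fun _ => Fin n) (fun _ => Fin n)) _
      (fun ab : (Fin m → Fin n) × (Fin m → Fin n) => (∏ l, q (ab.1 l) (ab.2 l)) *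
        G fun l => (ab.1 l, ab.2 (σ l))) (fun p => rfl)).trans ?_
    rw [Fintype.sum_prod_type]
    refine Finset.sum_congr rfl fun a _ => ?_
    conv_lhs => rw [← Equiv.sum_comp (Equiv.arrowCongr σ (Equiv.refl (Fin n)))]
    refine Finset.sum_congr rfl fun b _ => ?_
    rw [mul_comm]
    congr 1
    · simp
    · rw [← Equiv.prod_comp σ]
      simp
  simp_rw [h2, Finset.mul_sum]
  conv_rhs => rw [Finset.sum_comm]
  refine Finset.sum_congr rfl fun a _ => ?_
  conv_rhs => rw [Finset.sum_comm]
  refine Finset.sum_congr rfl fun b _ => ?_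
  rw [Matrix.det_apply', Finset.mul_sum]
  refine Finset.sum_congr rfl fun σ _ => ?_
  simp only [Matrix.of_apply]
  ring

theorem det_not_inj {n m : ℕ} (q : Fin n → Fin n → ℝ) (a b : Fin m → Fin n)
    (h : ¬ Function.Injective a) :
    Matrix.det (Matrix.of fun i j => q (a i) (b j)) = 0 := by
  simp only [Function.Injective, not_forall] at h
  obtain ⟨i, j, h1, h2⟩ := h
  apply Matrix.det_zero_of_row_eq h2
  funext l
  simp [h1]

theorem det_not_inj' {n m : ℕ} (q : Fin n → Fin n → ℝ) (a b : Fin m → Fin n)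
    (h : ¬ Function.Injective b) :
    Matrix.det (Matrix.of fun i j => q (a i) (b j)) = 0 := by
  simp only [Function.Injective, not_forall] at h
  obtain ⟨i, j, h1, h2⟩ := h
  apply Matrix.det_zero_of_column_eq h2
  intro l
  simp [h1]

theorem GCond_dirD {n m : ℕ} {T : J2 n → ℝ} (hT : ContDiff ℝ (⊤ : ℕ∞) T) (hADK : ADKfirst T)
    (z : J2 n) : GCond (fun p : Fin m → Fin n × Fin n =>
      dirD T (List.ofFn fun l => symE (p l).1 (p l).2) z) := by
  intro i k hik μ ρ₁ ρ₂ ρ₃ P₁ P₂ P₃ hP h1 h2 h3 h4 h5 h6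
  have hnd := List.nodup_finRange m
  have hki : k ∈ (List.finRange m).erase i :=
    (List.mem_erase_of_ne hik.symm).2 (List.mem_finRange k)
  have hp : (List.finRange m).Perm (i :: k :: ((List.finRange m).erase i).erase k) :=
    (List.perm_cons_erase (List.mem_finRange i)).trans ((List.perm_cons_erase hki).cons i)
  have key : ∀ P : Fin m → Fin n × Fin n, (∀ l, l ≠ i → l ≠ k → P l = P₃ l) →
      dirD T (List.ofFn fun l => symE (P l).1 (P l).2) z
      = dirD T (symE (P i).1 (P i).2 :: symE (P k).1 (P k).2 ::
        (((List.finRange m).erase i).erase k).map fun l => symE (P₃ l).1 (P₃ l).2) z := by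
    intro P hP'
    rw [List.ofFn_eq_map, dirD_perm hT (hp.map _)]
    simp only [List.map_cons]
    have : (((List.finRange m).erase i).erase k).map (fun l => symE (P l).1 (P l).2)
        = (((List.finRange m).erase i).erase k).map (fun l => symE (P₃ l).1 (P₃ l).2) := by
      apply List.map_congr_left
      intro l hl
      rw [(hnd.erase i).mem_erase_iff, hnd.mem_erase_iff] at hl
      rw [hP' l hl.2.1 hl.1]
    rw [this]
  simp only
  rw [key P₁ fun l a b => (hP l a b).1, key P₂ fun l a b => (hP l a b).2, key P₃ fun _ _ _ => rfl,
    h1, h2, h3, h4, h5, h6]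
  have hA := ADK_dirD hT hADK ((((List.finRange m).erase i).erase k).map
    fun l => symE (P₃ l).1 (P₃ l).2) μ ρ₁ ρ₂ ρ₃ z
  rw [dirD_perm hT (List.Perm.swap (symE ρ₁ ρ₂) (symE μ ρ₃) _)] at hA
  simp only
  rw [symE_comm ρ₁ μ, symE_comm ρ₃ ρ₂, symE_comm ρ₂ μ, symE_comm ρ₃ μ]
  exact hA

/-! ### Levi–Civita contractions -/

theorem lc_comp_perm {n : ℕ} (f : Fin n → Fin n) (σ : Equiv.Perm (Fin n)) :
    lc (f ∘ σ) = ((Equiv.Perm.sign σ : ℤ) : ℝ) * lc f := by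
  unfold lc
  by_cases h : Function.Bijective f
  · have h' : Function.Bijective (f ∘ σ) := h.comp σ.bijective
    rw [dif_pos h, dif_pos h']
    have : Equiv.ofBijective (f ∘ σ) h' = Equiv.ofBijective f h * σ := by
      ext x; simp
    rw [this, Equiv.Perm.sign_mul]
    push_cast
    ring
  · have h' : ¬ Function.Bijective (f ∘ σ) := fun h' => h (by
      have := h'.comp σ.symm.bijective
      simpa [Function.comp_assoc] using this)
    rw [dif_neg h, dif_neg h', mul_zero]

theorem lc_sq {n : ℕ} (f : Fin n → Fin n) (h : Function.Bijective f) : lc f * lc f = 1 := by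
  unfold lc
  rw [dif_pos h]
  rcases Int.units_eq_one_or (Equiv.Perm.sign (Equiv.ofBijective f h)) with h | h <;> simp [h]

/-- The Levi–Civita symbol of a concatenated tuple. -/
def LC {n k m : ℕ} (h : k + m = n) (μ : Fin k → Fin n) (a : Fin m → Fin n) : ℝ :=
  lc (Fin.append μ a ∘ Fin.cast h.symm)

theorem append_comp {N k m : ℕ} (μ : Fin k → Fin N) (a : Fin m → Fin N)
    (τ : Equiv.Perm (Fin k)) (σ : Equiv.Perm (Fin m)) :
    Fin.append (μ ∘ τ) (a ∘ σ)
      = Fin.append μ a ∘ (finSumFinEquiv.permCongr (Equiv.Perm.sumCongr τ σ)) := by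
  funext x
  refine Fin.addCases (fun i => ?_) (fun i => ?_) x <;> simp [Equiv.permCongr_apply]

theorem LC_comp {n k m : ℕ} (h : k + m = n) (μ : Fin k → Fin n) (a : Fin m → Fin n)
    (τ : Equiv.Perm (Fin k)) (σ : Equiv.Perm (Fin m)) :
    LC h (μ ∘ τ) (a ∘ σ) = ((Equiv.Perm.sign τ : ℤ) : ℝ) * ((Equiv.Perm.sign σ : ℤ) : ℝ)
      * LC h μ a := by
  subst h
  unfold LC
  have h1 : ∀ (f : Fin (k + m) → Fin (k + m)), f ∘ Fin.cast rfl = f := fun f => rfl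
  rw [h1, h1, append_comp, lc_comp_perm, Equiv.Perm.sign_permCongr, Equiv.Perm.sign_sumCongr]
  push_cast
  ring

theorem append_bij_iff {n k m : ℕ} (h : k + m = n) (μ : Fin k → Fin n) (a : Fin m → Fin n) :
    Function.Bijective (Fin.append μ a ∘ Fin.cast h.symm) ↔
      Function.Injective μ ∧ Function.Injective a ∧ ∀ i j, μ i ≠ a j := by
  rw [← Finite.injective_iff_bijective]
  subst h
  have h1 : ∀ (f : Fin (k + m) → Fin (k + m)), f ∘ Fin.cast rfl = f := fun f => rfl
  rw [h1, Fin.append_injective_iff]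

theorem LC_ne {n k m : ℕ} (h : k + m = n) (μ : Fin k → Fin n) (a : Fin m → Fin n)
    (h0 : LC h μ a ≠ 0) : Function.Bijective (Fin.append μ a ∘ Fin.cast h.symm) := by
  by_contra hb
  exact h0 (by unfold LC lc; rw [dif_neg hb])

theorem append_range {n k m : ℕ} (h : k + m = n) (μ : Fin k → Fin n) (a : Fin m → Fin n)
    (hb : Function.Bijective (Fin.append μ a ∘ Fin.cast h.symm)) :
    Set.range μ = (Set.range a)ᶜ := by
  obtain ⟨h1, h2, h3⟩ := (append_bij_iff h μ a).1 hb
  ext x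
  constructor
  · rintro ⟨i, rfl⟩ ⟨j, hj⟩
    exact h3 i j hj.symm
  · intro hx
    obtain ⟨y, hy⟩ := hb.2 x
    subst h
    revert hy
    refine Fin.addCases (fun i => ?_) (fun i => ?_) y
    · intro hy; exact ⟨i, by simpa using hy⟩
    · intro hy; exact absurd ⟨i, by simpa using hy⟩ hx

theorem perm_of_range {n m : ℕ} (a a' : Fin m → Fin n) (h : Function.Injective a)
    (h' : Function.Injective a') (hr : Set.range a = Set.range a') :
    ∃ σ : Equiv.Perm (Fin m), a ∘ σ = a' := by
  refine ⟨(Equiv.ofInjective a' h').trans ((Equiv.setCongr hr.symm).trans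
    (Equiv.ofInjective a h).symm), ?_⟩
  funext i
  have := Equiv.apply_ofInjective_symm h ((Equiv.setCongr hr.symm) (Equiv.ofInjective a' h' i))
  simpa using this

theorem sum_perm {n m : ℕ} (a : Fin m → Fin n) (h : Function.Injective a)
    (F : (Fin m → Fin n) → ℝ) (hF : ∀ a', F a' ≠ 0 → ∃ σ : Equiv.Perm (Fin m), a ∘ σ = a') :
    ∑ a', F a' = ∑ σ : Equiv.Perm (Fin m), F (a ∘ σ) := by
  symm
  refine Finset.sum_of_injOn (fun σ : Equiv.Perm (Fin m) => a ∘ σ) ?_ (by simp) ?_ (by simp)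
  · intro σ _ τ _ hστ
    ext i
    exact congrArg Fin.val (h (congrFun hστ i))
  · intro a' _ ha'
    by_contra h0
    obtain ⟨σ, hσ⟩ := hF a' h0
    exact ha' ⟨σ, by simp, hσ⟩

theorem exists_compl {n k m : ℕ} (h : k + m = n) (a : Fin m → Fin n)
    (ha : Function.Injective a) :
    ∃ μ : Fin k → Fin n, Function.Bijective (Fin.append μ a ∘ Fin.cast h.symm) := by
  have hc : ((Finset.univ.image a)ᶜ).card = k := by
    rw [Finset.card_compl, Finset.card_image_of_injective _ ha]
    simp
    omega
  refine ⟨fun i => ((Finset.univ.image a)ᶜ).orderEmbOfFin hc i, (append_bij_iff h _ a).2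
    ⟨(((Finset.univ.image a)ᶜ).orderEmbOfFin hc).injective, ha, ?_⟩⟩
  intro i j hij
  have := ((Finset.univ.image a)ᶜ).orderEmbOfFin_mem hc i
  rw [hij] at this
  simp at this

theorem LC_contract {n k m : ℕ} (h : k + m = n) (a : Fin m → Fin n)
    (ha : Function.Injective a) (H : (Fin m → Fin n) → ℝ) :
    ∑ a', (∑ μ, LC h μ a * LC h μ a') * H a'
      = (k.factorial : ℝ) * ∑ σ : Equiv.Perm (Fin m), ((Equiv.Perm.sign σ : ℤ) : ℝ) * H (a ∘ σ) := by
  obtain ⟨μ₀, h0⟩ := exists_compl h a ha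
  obtain ⟨hμ, -, -⟩ := (append_bij_iff h μ₀ a).1 h0
  have h1 : ∀ a', ∑ μ, LC h μ a * LC h μ a' = (k.factorial : ℝ) * (LC h μ₀ a * LC h μ₀ a') := by
    intro a'
    rw [sum_perm μ₀ hμ]
    · have : ∀ τ : Equiv.Perm (Fin k), LC h (μ₀ ∘ τ) a * LC h (μ₀ ∘ τ) a'
          = LC h μ₀ a * LC h μ₀ a' := by
        intro τ
        have e1 := LC_comp h μ₀ a τ 1
        have e2 := LC_comp h μ₀ a' τ 1
        simp only [Equiv.Perm.coe_one, Function.comp_id] at e1 e2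
        rw [e1, e2]
        rcases Int.units_eq_one_or (Equiv.Perm.sign τ) with h | h <;> simp [h]
      simp only [this, Finset.sum_const, Finset.card_univ, Fintype.card_perm, Fintype.card_fin,
        nsmul_eq_mul]
    · intro μ hne
      have hb := LC_ne h μ a (left_ne_zero_of_mul hne)
      exact perm_of_range μ₀ μ hμ ((append_bij_iff h μ a).1 hb).1
        ((append_range h _ _ h0).trans (append_range h _ _ hb).symm)
  simp only [h1]
  rw [sum_perm a ha, Finset.mul_sum]
  · refine Finset.sum_congr rfl fun σ _ => ?_
    have e1 := LC_comp h μ₀ a 1 σ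
    simp only [Equiv.Perm.coe_one, Function.comp_id] at e1
    have e2 : LC h μ₀ a * LC h μ₀ a = 1 := lc_sq _ h0
    rw [e1]
    simp only [Equiv.Perm.sign_one, Units.val_one, Int.cast_one, one_mul]
    linear_combination (k.factorial : ℝ) * ((Equiv.Perm.sign σ : ℤ) : ℝ) * H (a ∘ σ) * e2
  · intro a' hne
    have hb := LC_ne h μ₀ a' (right_ne_zero_of_mul (right_ne_zero_of_mul (left_ne_zero_of_mul hne)))
    refine perm_of_range a a' ha ((append_bij_iff h μ₀ a').1 hb).2.1 ?_
    have r1 := append_range h _ _ h0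
    have r2 := append_range h _ _ hb
    exact compl_injective (r1.symm.trans r2)

theorem LC_contract_zero {n k m : ℕ} (h : k + m = n) (a : Fin m → Fin n)
    (ha : ¬ Function.Injective a) (μ : Fin k → Fin n) : LC h μ a = 0 := by
  by_contra h0
  exact ha ((append_bij_iff h μ a).1 (LC_ne h μ a h0)).2.1

theorem LC_det {n k m : ℕ} (h : k + m = n) (a b : Fin m → Fin n) (q : Fin n → Fin n → ℝ) :
    ∑ a', (∑ μ, LC h μ a * LC h μ a') * ∑ b', (∑ ν, LC h ν b * LC h ν b') * ∏ i, q (a' i) (b' i)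
      = (k.factorial : ℝ) ^ 2 * (m.factorial : ℝ) *
        Matrix.det (Matrix.of fun i j => q (a i) (b j)) := by
  by_cases ha : Function.Injective a
  · by_cases hb : Function.Injective b
    · rw [LC_contract h a ha]
      simp only [LC_contract h b hb]
      have h1 : ∀ σ : Equiv.Perm (Fin m), ((Equiv.Perm.sign σ : ℤ) : ℝ) *
          ((k.factorial : ℝ) * ∑ τ : Equiv.Perm (Fin m), ((Equiv.Perm.sign τ : ℤ) : ℝ) *
            ∏ i, q ((a ∘ σ) i) ((b ∘ τ) i))
          = (k.factorial : ℝ) * Matrix.det (Matrix.of fun i j => q (a i) (b j)) := by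
        intro σ
        rw [← Matrix.det_transpose, Matrix.det_apply', ← Equiv.sum_comp (Equiv.mulRight σ)]
        rw [mul_left_comm, Finset.mul_sum]
        congr 1
        refine Finset.sum_congr rfl fun τ _ => ?_
        rw [← Equiv.prod_comp σ (fun i => (Matrix.of fun i j => q (a i) (b j)).transpose
          (τ i) i)]
        simp only [Matrix.transpose_apply, Matrix.of_apply, Equiv.coe_mulRight,
          Equiv.Perm.sign_mul, Function.comp_apply, Equiv.Perm.coe_mul]
        rcases Int.units_eq_one_or (Equiv.Perm.sign σ) with h | h <;> simp [h]
      rw [Finset.sum_congr rfl fun σ _ => h1 σ]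
      simp only [Finset.sum_const, Finset.card_univ, Fintype.card_perm, Fintype.card_fin,
        nsmul_eq_mul]
      ring
    · rw [det_not_inj' q a b hb]
      simp [LC_contract_zero h b hb]
  · rw [det_not_inj q a b ha]
    simp [LC_contract_zero h a ha]

/-! ### Assembling the theorem -/

theorem LC_minor {n k m : ℕ} (h : k + m = n) (A : (Fin m → Fin n) → (Fin m → Fin n) → ℝ)
    (C : ℝ) (q : Fin n → Fin n → ℝ) :
    ((k.factorial : ℝ)⁻¹) ^ 2 * ∑ μ : Fin k → Fin n, ∑ ν : Fin k → Fin n,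
      (C * ∑ a, ∑ b, LC h μ a * LC h ν b * A a b) *
        ((m.factorial : ℝ)⁻¹ * ∑ a', ∑ b', LC h μ a' * LC h ν b' * ∏ i, q (a' i) (b' i))
      = C * ∑ a, ∑ b, A a b * Matrix.det (Matrix.of fun i j => q (a i) (b j)) := by
  have hk : (k.factorial : ℝ) ≠ 0 := by positivity
  have hm : (m.factorial : ℝ) ≠ 0 := by positivity
  have h1 : ∑ μ : Fin k → Fin n, ∑ ν : Fin k → Fin n,
      (∑ a, ∑ b, LC h μ a * LC h ν b * A a b) *
        (∑ a', ∑ b', LC h μ a' * LC h ν b' * ∏ i, q (a' i) (b' i))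
      = ∑ a, ∑ b, A a b * ∑ a', (∑ μ, LC h μ a * LC h μ a') *
          ∑ b', (∑ ν, LC h ν b * LC h ν b') * ∏ i, q (a' i) (b' i) := by
    simp only [Finset.sum_mul, Finset.mul_sum, ← Fintype.sum_prod_type']
    refine Fintype.sum_equiv ⟨fun x => ⟨x.2.2.2.1, x.2.2.2.2, x.2.2.1.1, ⟨x.2.2.1.2, x.2.1⟩, x.1⟩,
      fun x => ⟨x.2.2.2.2, x.2.2.2.1.2, ⟨x.2.2.1, x.2.2.2.1.1⟩, ⟨x.1, x.2.1⟩⟩,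
      fun _ => rfl, fun _ => rfl⟩ _ _ ?_
    intro x
    simp only [Equiv.coe_fn_mk]
    ring
  simp only [LC_det] at h1
  have h2 : ∀ (μ ν : Fin k → Fin n), (C * ∑ a, ∑ b, LC h μ a * LC h ν b * A a b) *
        ((m.factorial : ℝ)⁻¹ * ∑ a', ∑ b', LC h μ a' * LC h ν b' * ∏ i, q (a' i) (b' i))
      = (C * (m.factorial : ℝ)⁻¹) * ((∑ a, ∑ b, LC h μ a * LC h ν b * A a b) *
        (∑ a', ∑ b', LC h μ a' * LC h ν b' * ∏ i, q (a' i) (b' i))) := by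
    intro μ ν; ring
  simp only [h2, ← Finset.mul_sum]
  rw [h1]
  have h3 : ∀ (a b : Fin m → Fin n), A a b * ((k.factorial : ℝ) ^ 2 * (m.factorial : ℝ) *
      Matrix.det (Matrix.of fun i j => q (a i) (b j)))
      = ((k.factorial : ℝ) ^ 2 * (m.factorial : ℝ)) *
        (A a b * Matrix.det (Matrix.of fun i j => q (a i) (b j))) := by
    intro a b; ring
  simp only [h3, ← Finset.mul_sum]
  field_simp

/-- The Taylor coefficients of `T` in the second-order variables. -/
def tayA {n : ℕ} (T : J2 n → ℝ) (m : ℕ) (a b : Fin m → Fin n) (w : J1 n) : ℝ :=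
  dirD T (List.ofFn fun l => symE (a l) (b l)) (w.1, w.2.1, w.2.2, 0)

/-- The coefficients of the minor-polynomial representation. -/
def coefC {n : ℕ} (T : J2 n → ℝ) (D : ℕ → ℝ) (k : ℕ) (μ ν : Fin k → Fin n) (w : J1 n) : ℝ :=
  if h : k + (n - k) = n then
    (D (n - k) * ((n - k).factorial : ℝ))⁻¹ *
      ∑ a : Fin (n - k) → Fin n, ∑ b : Fin (n - k) → Fin n,
        LC h μ a * LC h ν b * tayA T (n - k) a b w
  else 0

theorem tayA_comm {n : ℕ} (T : J2 n → ℝ) (m : ℕ) (a b : Fin m → Fin n) (w : J1 n) :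
    tayA T m a b w = tayA T m b a w := by
  unfold tayA
  simp only [symE_comm]

theorem coefC_ok {n : ℕ} {T : J2 n → ℝ} (hT : ContDiff ℝ (⊤ : ℕ∞) T) (D : ℕ → ℝ) :
    MinorCoeffOK (coefC T D) := by
  refine ⟨?_, ?_, ?_, ?_⟩
  · intro k μ ν
    by_cases h : k + (n - k) = n
    · have h1 : ∀ a b, ContDiff ℝ (⊤ : ℕ∞) (tayA T (n - k) a b) := by
        intro a b
        unfold tayA
        exact (dirD_contDiff hT _).comp (by fun_prop)
      unfold coefC
      simp only [dif_pos h]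
      refine contDiff_const.mul (ContDiff.sum fun a _ => ContDiff.sum fun b _ =>
        contDiff_const.mul (h1 a b))
    · unfold coefC
      simp only [dif_neg h]
      exact contDiff_const
  · intro k μ ν σ w
    unfold coefC
    split_ifs with h
    · have e : ∀ a, LC h (μ ∘ σ) a = ((Equiv.Perm.sign σ : ℤ) : ℝ) * LC h μ a := by
        intro a
        simpa using LC_comp h μ a σ 1
      simp only [e, mul_assoc, Finset.mul_sum]
      refine Finset.sum_congr rfl fun a _ => Finset.sum_congr rfl fun b _ => ?_
      ring
    · simp
  · intro k μ ν σ w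
    unfold coefC
    split_ifs with h
    · have e : ∀ a, LC h (ν ∘ σ) a = ((Equiv.Perm.sign σ : ℤ) : ℝ) * LC h ν a := by
        intro a
        simpa using LC_comp h ν a σ 1
      simp only [e, Finset.mul_sum]
      refine Finset.sum_congr rfl fun a _ => Finset.sum_congr rfl fun b _ => ?_
      ring
    · simp
  · intro k μ ν w
    unfold coefC
    split_ifs with h
    · rw [Finset.sum_comm]
      congr 1
      refine Finset.sum_congr rfl fun a _ => Finset.sum_congr rfl fun b _ => ?_
      rw [tayA_comm]
      ring
    · rfl

theorem minor_polynomial_structure {n : ℕ} (hn : 1 ≤ n) (T : J2 n → ℝ)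
    (hT : ContDiff ℝ (⊤ : ℕ∞) T) (hsym : SymmDep T) (hADK : ADKfirst T) :
    MinorPolyForm T := by

  choose D hD hD' using SS_sum
  refine ⟨coefC T D, coefC_ok hT D, ?_⟩
  intro x ψ p q'
  rw [hsym]
  set q := symmM q' with hqdef
  have hq : ∀ i j, q i j = q j i := by
    intro i j
    simp only [hqdef, symmM]
    rw [add_comm]
  have hkey : ∀ (m : ℕ) (z : J2 n), D m * dirD T (List.replicate m q) z
      = ∑ a : Fin m → Fin n, ∑ b : Fin m → Fin n,
        dirD T (List.ofFn fun l => symE (a l) (b l)) z *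
          Matrix.det (Matrix.of fun i j => q (a i) (b j)) := by
    intro m z
    rw [dirD_replicate hT q hq, ← hD' m n _ (GCond_dirD hT hADK z) q hq]
  have hzero : ∀ t : ℝ, dirD T (List.replicate (n + 1) q) (x, ψ, p, t • q) = 0 := by
    intro t
    have h1 := hkey (n + 1) (x, ψ, p, t • q)
    rw [Finset.sum_eq_zero] at h1
    · exact (mul_eq_zero.1 h1).resolve_left (hD (n + 1)).ne'
    · intro a _
      refine Finset.sum_eq_zero fun b _ => ?_
      rw [det_not_inj, mul_zero]
      intro ha
      have := Fintype.card_le_of_injective a ha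
      simp at this
  have htay := taylor_poly (n + 1)
    (fun m t => dirD T (List.replicate m q) (x, ψ, p, t • q))
    (fun m t => dirD_hasDerivAt hT q x ψ p m t) hzero 1
  simp only [List.replicate_zero, one_smul, zero_smul, one_pow] at htay
  change T (x, ψ, p, q) = _ at htay
  rw [htay, ← Finset.sum_range_reflect]
  refine Finset.sum_congr rfl fun k hk => ?_
  have hkn : k + (n - k) = n := by
    have := Finset.mem_range.1 hk
    omega
  have hnk : n + 1 - 1 - k = n - k := by omega
  rw [hnk]
  have hf : ((n - k).factorial : ℝ) ≠ 0 := by positivity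
  have hDne := (hD (n - k)).ne'
  have h3 := LC_minor hkn (fun a b => tayA T (n - k) a b (x, ψ, p))
    (D (n - k) * ((n - k).factorial : ℝ))⁻¹ q
  have h4 := hkey (n - k) (x, ψ, p, 0)
  have h5 : ((k.factorial : ℝ)⁻¹) ^ 2 * ∑ μ : Fin k → Fin n, ∑ ν : Fin k → Fin n,
      coefC T D k μ ν (x, ψ, p) * minorP k μ ν q
      = (D (n - k) * ((n - k).factorial : ℝ))⁻¹ *
        (D (n - k) * dirD T (List.replicate (n - k) q) (x, ψ, p, 0)) := by
    rw [h4]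
    refine Eq.trans ?_ h3
    simp only [coefC, minorP, dif_pos hkn]
    rfl
  rw [h5]
  field_simp

end
end

section
/- Let n ≥ 1 and let T be a smooth function on J² of the minor-polynomial form, i.e. T = Σ_{k=0}^{n} (1/(k!)²) T_{μ₁…μ_k;ν₁…ν_k} ψ^{μ₁…μ_k;ν₁…ν_k} with smooth coefficients T_{μ₁…μ_k;ν₁…ν_k} depending only on (x^μ, ψ, ψ_μ), completely antisymmetric in μ₁,…,μ_k, completely antisymmetric in ν₁,…,ν_k, and symmetric under the interchange (μ₁,…,μ_k) ↔ (ν₁,…,ν_k). Then T satisfies (ADK′): for all μ,ρ₁,ρ₂,ρ₃, ∂^{μρ₁}∂^{ρ₂ρ₃}T + ∂^{μρ₂}∂^{ρ₃ρ₁}T + ∂^{μρ₃}∂^{ρ₁ρ₂}T = 0. -/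
open scoped BigOperators

noncomputable section

theorem lc_swap_aux {n : ℕ} (f : Fin n → Fin n) (x y : Fin n) (hxy : x ≠ y) :
    lc (f ∘ Equiv.swap x y) = - lc f := by
  unfold lc
  by_cases h : Function.Bijective f
  · have h' : Function.Bijective (f ∘ Equiv.swap x y) := h.comp (Equiv.bijective _)
    rw [dif_pos h, dif_pos h']
    have : Equiv.ofBijective _ h' = Equiv.ofBijective f h * Equiv.swap x y := by
      ext i; simp
    rw [this, Equiv.Perm.sign_mul, Equiv.Perm.sign_swap hxy]
    simp
  · have h' : ¬ Function.Bijective (f ∘ Equiv.swap x y) := by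
      intro hb
      apply h
      have := hb.comp (Equiv.bijective (Equiv.swap x y))
      convert this using 1
      ext i; simp
    rw [dif_neg h, dif_neg h']
    simp

theorem lc_append_swap {n k m : ℕ} (h : k + m = n) (μ : Fin k → Fin n) (a : Fin m → Fin n)
    (i j : Fin m) (hij : i ≠ j) :
    lc (Fin.append μ (a ∘ Equiv.swap i j) ∘ Fin.cast h.symm) =
      - lc (Fin.append μ a ∘ Fin.cast h.symm) := by
  subst h
  have hne : Fin.natAdd k i ≠ Fin.natAdd k j := by
    intro he; exact hij ((Fin.natAdd_injective _ _) he)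
  rw [← lc_swap_aux _ _ _ hne]
  congr 1
  funext x
  simp only [Function.comp, Fin.cast_refl, id]
  refine Fin.addCases (fun l => ?_) (fun l => ?_) x
  · rw [Equiv.swap_apply_of_ne_of_ne]
    · simp
    · intro he; have := congrArg Fin.val he; simp at this; omega
    · intro he; have := congrArg Fin.val he; simp at this; omega
  · rw [(Fin.natAdd_injective m k).swap_apply]
    simp

theorem key_cancel {n m : ℕ} (α β : (Fin m → Fin n) → ℝ)
    (hα : ∀ a i j, i ≠ j → α (a ∘ Equiv.swap i j) = - α a)
    (hβ : ∀ a i j, i ≠ j → β (a ∘ Equiv.swap i j) = - β a)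
    (s : Fin n → Fin n → ℝ) (K : Fin n → Fin n → Fin n → Fin n → ℝ)
    (hK : ∀ p q r t, K p q r t - K r q p t - K p t r q + K r t p q = 0) :
    ∑ a : Fin m → Fin n, ∑ b : Fin m → Fin n, α a * β b *
      ∑ i, ∑ j ∈ Finset.univ.erase i, (∏ l ∈ (Finset.univ.erase i).erase j, s (a l) (b l)) *
        K (a i) (b i) (a j) (b j) = 0 := by
  simp only [Finset.mul_sum]
  have step : ∀ F : (Fin m → Fin n) → (Fin m → Fin n) → Fin m → Fin m → ℝ,
      ∑ a, ∑ b, ∑ i, ∑ j ∈ Finset.univ.erase i, F a b i j =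
      ∑ i, ∑ j ∈ Finset.univ.erase i, ∑ a, ∑ b, F a b i j := by
    intro F
    calc _ = ∑ a, ∑ i, ∑ b, ∑ j ∈ Finset.univ.erase i, F a b i j :=
          Finset.sum_congr rfl fun a _ => Finset.sum_comm
      _ = ∑ i, ∑ a, ∑ b, ∑ j ∈ Finset.univ.erase i, F a b i j := Finset.sum_comm
      _ = ∑ i, ∑ a, ∑ j ∈ Finset.univ.erase i, ∑ b, F a b i j :=
          Finset.sum_congr rfl fun i _ => Finset.sum_congr rfl fun a _ => Finset.sum_comm
      _ = _ := Finset.sum_congr rfl fun i _ => Finset.sum_comm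
  rw [step]
  refine Finset.sum_eq_zero fun i _ => Finset.sum_eq_zero fun j hj => ?_
  have hij : i ≠ j := (Finset.ne_of_mem_erase hj).symm
  set P : (Fin m → Fin n) → (Fin m → Fin n) → ℝ :=
    fun a b => ∏ l ∈ (Finset.univ.erase i).erase j, s (a l) (b l) with hP
  have hsw : ∀ l ∈ (Finset.univ.erase i).erase j, Equiv.swap i j l = l := by
    intro l hl
    simp only [Finset.mem_erase, Finset.mem_univ, and_true] at hl
    exact Equiv.swap_apply_of_ne_of_ne hl.2 hl.1
  have hPa : ∀ a b, P (a ∘ Equiv.swap i j) b = P a b := fun a b =>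
    Finset.prod_congr rfl fun l hl => by simp only [Function.comp]; rw [hsw l hl]
  have hPb : ∀ a b, P a (b ∘ Equiv.swap i j) = P a b := fun a b =>
    Finset.prod_congr rfl fun l hl => by simp only [Function.comp]; rw [hsw l hl]
  have reA : ∀ G : (Fin m → Fin n) → ℝ, ∑ a, G (a ∘ Equiv.swap i j) = ∑ a, G a := fun G =>
    Equiv.sum_comp ((Equiv.swap i j).arrowCongr (Equiv.refl (Fin n))) G
  change ∑ a, ∑ b, α a * β b * (P a b * K (a i) (b i) (a j) (b j)) = 0
  set S : ℝ := ∑ a, ∑ b, α a * β b * (P a b * K (a i) (b i) (a j) (b j)) with hS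
  have e1 : S = ∑ a, ∑ b, -(α a * β b * (P a b * K (a j) (b i) (a i) (b j))) := by
    rw [hS, ← reA]
    refine Finset.sum_congr rfl fun a _ => Finset.sum_congr rfl fun b _ => ?_
    rw [hα a i j hij, hPa]; simp
  have e2 : S = ∑ a, ∑ b, -(α a * β b * (P a b * K (a i) (b j) (a j) (b i))) := by
    rw [hS]
    refine Finset.sum_congr rfl fun a _ => ?_
    rw [← reA]
    refine Finset.sum_congr rfl fun b _ => ?_
    rw [hβ b i j hij, hPb]; simp
  have e3 : S = ∑ a, ∑ b, (α a * β b * (P a b * K (a j) (b j) (a i) (b i))) := by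
    rw [e1]
    refine Finset.sum_congr rfl fun a _ => ?_
    rw [← reA]
    refine Finset.sum_congr rfl fun b _ => ?_
    rw [hβ b i j hij, hPb]; simp
  have e4 : S + S + S + S = 0 := by
    calc S + S + S + S = (∑ a, ∑ b, α a * β b * (P a b * K (a i) (b i) (a j) (b j))) +
          (∑ a, ∑ b, -(α a * β b * (P a b * K (a j) (b i) (a i) (b j)))) +
          (∑ a, ∑ b, -(α a * β b * (P a b * K (a i) (b j) (a j) (b i)))) +
          (∑ a, ∑ b, (α a * β b * (P a b * K (a j) (b j) (a i) (b i)))) := by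
            rw [← e1, ← e2, ← e3]
      _ = 0 := ?_
    simp only [← Finset.sum_add_distrib]
    refine Finset.sum_eq_zero fun a _ => Finset.sum_eq_zero fun b _ => ?_
    linear_combination (α a * β b * P a b) * hK (a i) (b i) (a j) (b j)
  linarith

theorem symmM_symE {n : ℕ} (μ ν : Fin n) : symmM (symE μ ν) = symE μ ν := by
  funext i j
  simp only [symmM, symE, and_comm]
  ring

theorem symE_eq {n : ℕ} (μ ν i j : Fin n) : symE μ ν i j =
    ((if i = μ then (1:ℝ) else 0) * (if j = ν then 1 else 0) +
      (if i = ν then (1:ℝ) else 0) * (if j = μ then 1 else 0)) / 2 := by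
  simp only [symE, ite_and, mul_ite, mul_one, mul_zero, ite_mul, one_mul, zero_mul]
  split_ifs <;> simp

theorem K_identity {n : ℕ} (μ ρ₁ ρ₂ ρ₃ p q r t : Fin n) 
    (K : Fin n → Fin n → Fin n → Fin n → ℝ)
    (hK : K = fun p q r t => symE ρ₂ ρ₃ p q * symE μ ρ₁ r t + symE ρ₃ ρ₁ p q * symE μ ρ₂ r t
      + symE ρ₁ ρ₂ p q * symE μ ρ₃ r t) :
    K p q r t - K r q p t - K p t r q + K r t p q = 0 := by
  subst hK
  simp only [symE_eq]
  generalize (if p = μ then (1:ℝ) else 0) = p0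
  generalize (if p = ρ₁ then (1:ℝ) else 0) = p1
  generalize (if p = ρ₂ then (1:ℝ) else 0) = p2
  generalize (if p = ρ₃ then (1:ℝ) else 0) = p3
  generalize (if q = μ then (1:ℝ) else 0) = q0
  generalize (if q = ρ₁ then (1:ℝ) else 0) = q1
  generalize (if q = ρ₂ then (1:ℝ) else 0) = q2
  generalize (if q = ρ₃ then (1:ℝ) else 0) = q3
  generalize (if r = μ then (1:ℝ) else 0) = r0
  generalize (if r = ρ₁ then (1:ℝ) else 0) = r1
  generalize (if r = ρ₂ then (1:ℝ) else 0) = r2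
  generalize (if r = ρ₃ then (1:ℝ) else 0) = r3
  generalize (if t = μ then (1:ℝ) else 0) = t0
  generalize (if t = ρ₁ then (1:ℝ) else 0) = t1
  generalize (if t = ρ₂ then (1:ℝ) else 0) = t2
  generalize (if t = ρ₃ then (1:ℝ) else 0) = t3
  ring

/-- Entry functional of the symmetrization. -/
def entryL {n : ℕ} (i j : Fin n) : (Fin n → Fin n → ℝ) →L[ℝ] ℝ :=
  (2⁻¹ : ℝ) • ((ContinuousLinearMap.proj j).comp
      (ContinuousLinearMap.proj (R := ℝ) (φ := fun _ : Fin n => Fin n → ℝ) i) +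
    (ContinuousLinearMap.proj i).comp
      (ContinuousLinearMap.proj (R := ℝ) (φ := fun _ : Fin n => Fin n → ℝ) j))

theorem entryL_apply {n : ℕ} (i j : Fin n) (q : Fin n → Fin n → ℝ) :
    entryL i j q = symmM q i j := by
  simp [entryL, symmM]; ring

theorem hasF_prod {n m : ℕ} (a b : Fin m → Fin n) (s : Finset (Fin m))
    (q : Fin n → Fin n → ℝ) :
    HasFDerivAt (fun q : Fin n → Fin n → ℝ => ∏ i ∈ s, symmM q (a i) (b i))
      (∑ i ∈ s, (∏ j ∈ s.erase i, symmM q (a j) (b j)) • entryL (a i) (b i)) q := by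
  have := HasFDerivAt.finset_prod (u := s) (x := q)
    (g := fun i (q : Fin n → Fin n → ℝ) => symmM q (a i) (b i))
    (g' := fun i => entryL (a i) (b i)) (fun i _ => by
      simp only [← entryL_apply]
      exact (entryL (a i) (b i)).hasFDerivAt)
  exact this

/-- First directional derivative of the symmetrized minor. -/
theorem dminor {n : ℕ} (k : ℕ) (h : k + (n - k) = n) (μ ν : Fin k → Fin n)
    (A q : Fin n → Fin n → ℝ) :
    fderiv ℝ (fun q => minorP k μ ν (symmM q)) q A =
     ((n - k).factorial : ℝ)⁻¹ *
      ∑ a : Fin (n - k) → Fin n, ∑ b : Fin (n - k) → Fin n,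
        lc (Fin.append μ a ∘ Fin.cast h.symm) * lc (Fin.append ν b ∘ Fin.cast h.symm) *
          ∑ i, (∏ j ∈ Finset.univ.erase i, symmM q (a j) (b j)) * symmM A (a i) (b i) := by
  simp only [minorP, dif_pos h]
  have := (HasFDerivAt.fun_sum (u := Finset.univ) (x := q) fun a _ =>
    HasFDerivAt.fun_sum (u := Finset.univ) fun b _ => (hasF_prod a b Finset.univ q).const_mul
      (lc (Fin.append μ a ∘ Fin.cast h.symm) * lc (Fin.append ν b ∘ Fin.cast h.symm))).const_mul
      ((n - k).factorial : ℝ)⁻¹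
  rw [this.fderiv]
  simp [entryL_apply, ContinuousLinearMap.sum_apply]

theorem ddminor {n : ℕ} (k : ℕ) (h : k + (n - k) = n) (μ ν : Fin k → Fin n)
    (A B q : Fin n → Fin n → ℝ) :
    fderiv ℝ (fun q => fderiv ℝ (fun q => minorP k μ ν (symmM q)) q A) q B =
     ((n - k).factorial : ℝ)⁻¹ *
      ∑ a : Fin (n - k) → Fin n, ∑ b : Fin (n - k) → Fin n,
        lc (Fin.append μ a ∘ Fin.cast h.symm) * lc (Fin.append ν b ∘ Fin.cast h.symm) *
          ∑ i, ∑ j ∈ Finset.univ.erase i,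
            (∏ l ∈ (Finset.univ.erase i).erase j, symmM q (a l) (b l)) *
             (symmM A (a i) (b i) * symmM B (a j) (b j)) := by
  simp only [dminor k h]
  have := (HasFDerivAt.fun_sum (u := Finset.univ) (x := q) fun a _ =>
    HasFDerivAt.fun_sum (u := Finset.univ) fun b _ => 
     (HasFDerivAt.fun_sum (u := Finset.univ) fun i _ =>
      (hasF_prod a b (Finset.univ.erase i) q).mul_const (symmM A (a i) (b i))).const_mul
      (lc (Fin.append μ a ∘ Fin.cast h.symm) * lc (Fin.append ν b ∘ Fin.cast h.symm))).const_mul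
      ((n - k).factorial : ℝ)⁻¹
  rw [this.fderiv]
  simp only [entryL_apply, ContinuousLinearMap.sum_apply, ContinuousLinearMap.smul_apply,
    smul_eq_mul]
  congr 1
  refine Finset.sum_congr rfl fun a _ => Finset.sum_congr rfl fun b _ => ?_
  congr 1
  refine Finset.sum_congr rfl fun i _ => ?_
  rw [Finset.mul_sum]
  refine Finset.sum_congr rfl fun j _ => ?_
  ring

theorem contDiff_minor {n : ℕ} (k : ℕ) (μ ν : Fin k → Fin n) :
    ContDiff ℝ (⊤ : ℕ∞) (fun q : Fin n → Fin n → ℝ => minorP k μ ν (symmM q)) := by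
  unfold minorP
  split_ifs with h
  · simp only [← entryL_apply]
    refine contDiff_const.mul (ContDiff.sum fun a _ => ContDiff.sum fun b _ =>
      contDiff_const.mul (contDiff_prod fun i _ => (entryL (a i) (b i)).contDiff))
  · exact contDiff_const

theorem minor_ADK {n : ℕ} (k : ℕ) (h : k + (n - k) = n) (μ' ν' : Fin k → Fin n)
    (μ ρ₁ ρ₂ ρ₃ : Fin n) (q : Fin n → Fin n → ℝ) :
    fderiv ℝ (fun q => fderiv ℝ (fun q => minorP k μ' ν' (symmM q)) q (symE ρ₂ ρ₃)) q
      (symE μ ρ₁) +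
    fderiv ℝ (fun q => fderiv ℝ (fun q => minorP k μ' ν' (symmM q)) q (symE ρ₃ ρ₁)) q
      (symE μ ρ₂) +
    fderiv ℝ (fun q => fderiv ℝ (fun q => minorP k μ' ν' (symmM q)) q (symE ρ₁ ρ₂)) q
      (symE μ ρ₃) = 0 := by
  simp only [ddminor k h, symmM_symE]
  rw [← mul_add, ← mul_add]
  have := key_cancel (fun a => lc (Fin.append μ' a ∘ Fin.cast h.symm))
    (fun a => lc (Fin.append ν' a ∘ Fin.cast h.symm))
    (fun a i j hij => lc_append_swap h μ' a i j hij)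
    (fun a i j hij => lc_append_swap h ν' a i j hij) (symmM q) _
    (fun p q r t => K_identity μ ρ₁ ρ₂ ρ₃ p q r t _ rfl)
  rw [mul_eq_zero]; right
  rw [← this]
  simp only [← Finset.sum_add_distrib, ← mul_add]

theorem pd2_sum {n : ℕ} {ι : Type*} (s : Finset ι) (f : ι → J2 n → ℝ) (μ ν : Fin n)
    (hf : ∀ i ∈ s, Differentiable ℝ (f i)) :
    pd2 (fun z => ∑ i ∈ s, f i z) μ ν = fun z => ∑ i ∈ s, pd2 (f i) μ ν z := by
  funext z
  unfold pd2
  rw [fderiv_fun_sum fun i hi => (hf i hi) z, ContinuousLinearMap.sum_apply]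

theorem pd2_mul {n : ℕ} (C : J1 n → ℝ) (g : (Fin n → Fin n → ℝ) → ℝ) (μ ν : Fin n)
    (hC : Differentiable ℝ C) (hg : Differentiable ℝ g) :
    pd2 (fun z : J2 n => C (z.1, z.2.1, z.2.2.1) * g z.2.2.2) μ ν =
      fun z => C (z.1, z.2.1, z.2.2.1) * fderiv ℝ g z.2.2.2 (symE μ ν) := by
  funext z
  unfold pd2
  let L : J2 n →L[ℝ] J1 n := (ContinuousLinearMap.fst ℝ _ _).prod
    (((ContinuousLinearMap.fst ℝ _ _).comp (ContinuousLinearMap.snd ℝ _ _)).prod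
      ((ContinuousLinearMap.fst ℝ _ _).comp
        ((ContinuousLinearMap.snd ℝ _ _).comp (ContinuousLinearMap.snd ℝ _ _))))
  let R : J2 n →L[ℝ] (Fin n → Fin n → ℝ) := (ContinuousLinearMap.snd ℝ _ _).comp
        ((ContinuousLinearMap.snd ℝ _ _).comp (ContinuousLinearMap.snd ℝ _ _))
  have h1 : HasFDerivAt (fun z => C (L z)) ((fderiv ℝ C (L z)).comp L) z :=
    (hC (L z)).hasFDerivAt.comp z L.hasFDerivAt
  have h2 : HasFDerivAt (fun z => g (R z)) ((fderiv ℝ g (R z)).comp R) z :=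
    (hg (R z)).hasFDerivAt.comp z R.hasFDerivAt
  have h3 := (h1.mul h2).fderiv
  change fderiv ℝ (fun z => C (L z) * g (R z)) z _ = C (L z) * fderiv ℝ g (R z) _
  have hL : L (0, 0, 0, symE μ ν) = 0 := rfl
  have hR : R (0, 0, 0, symE μ ν) = symE μ ν := rfl
  erw [h3]
  simp [hL, hR]

theorem diff_mul {n : ℕ} (C : J1 n → ℝ) (g : (Fin n → Fin n → ℝ) → ℝ)
    (hC : Differentiable ℝ C) (hg : Differentiable ℝ g) :
    Differentiable ℝ (fun z : J2 n => C (z.1, z.2.1, z.2.2.1) * g z.2.2.2) := by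
  fun_prop

theorem diff_dg {n : ℕ} (g : (Fin n → Fin n → ℝ) → ℝ) (hg : ContDiff ℝ (⊤ : ℕ∞) g)
    (A : Fin n → Fin n → ℝ) : Differentiable ℝ (fun q => fderiv ℝ g q A) := by
  have : Differentiable ℝ (fderiv ℝ g) :=
    (hg.fderiv_right (m := 1) (WithTop.coe_le_coe.2 (le_top : (1 + 1 : ℕ∞) ≤ ⊤))).differentiable (by simp)
  exact fun q => (this q).clm_apply (differentiableAt_const _)

theorem minor_polynomial_satisfies_ADK' {n : ℕ} (hn : 1 ≤ n) (T : J2 n → ℝ)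
    (c : (k : ℕ) → (Fin k → Fin n) → (Fin k → Fin n) → J1 n → ℝ)
    (hc : MinorCoeffOK c) (hrep : MinorRep T c) :
    ADKfirst T := by
  let ι := Σ k : ℕ, (Fin k → Fin n) × (Fin k → Fin n)
  let s : Finset ι := (Finset.range (n + 1)).sigma fun k => Finset.univ
  let C : ι → J1 n → ℝ := fun i w => ((i.1.factorial : ℝ)⁻¹) ^ 2 * c i.1 i.2.1 i.2.2 w
  let g : ι → (Fin n → Fin n → ℝ) → ℝ := fun i q => minorP i.1 i.2.1 i.2.2 (symmM q)
  have hC : ∀ i, Differentiable ℝ (C i) := fun i =>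
    ((hc.1 i.1 i.2.1 i.2.2).differentiable (by simp)).const_mul _
  have hg : ∀ i, ContDiff ℝ (⊤ : ℕ∞) (g i) := fun i => contDiff_minor _ _ _
  have hgd : ∀ i, Differentiable ℝ (g i) := fun i => (hg i).differentiable (by simp)
  have hT : T = fun z => ∑ i ∈ s, C i (z.1, z.2.1, z.2.2.1) * g i z.2.2.2 := by
    funext z
    obtain ⟨x, ψ, p, q⟩ := z
    rw [hrep x ψ p q, Finset.sum_sigma]
    refine Finset.sum_congr rfl fun k _ => ?_
    simp only [Fintype.sum_prod_type, Finset.mul_sum, C, g, mul_assoc]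
  have h2 : ∀ a b d e, pd2 (pd2 T a b) d e = fun z => ∑ i ∈ s, C i (z.1, z.2.1, z.2.2.1) *
      fderiv ℝ (fun q => fderiv ℝ (g i) q (symE a b)) z.2.2.2 (symE d e) := by
    intro a b d e
    rw [hT, pd2_sum _ _ _ _ fun i _ => diff_mul _ _ (hC i) (hgd i)]
    simp only [pd2_mul _ _ _ _ (hC _) (hgd _)]
    rw [pd2_sum _ _ _ _ fun i _ => diff_mul _ _ (hC i) (diff_dg _ (hg i) _)]
    simp only [pd2_mul _ _ _ _ (hC _) (diff_dg _ (hg _) _)]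
  intro μ ρ₁ ρ₂ ρ₃ z
  rw [h2, h2, h2]
  simp only [← Finset.sum_add_distrib, ← mul_add]
  refine Finset.sum_eq_zero fun i hi => ?_
  have hk : i.1 + (n - i.1) = n := by
    have := Finset.mem_range.1 (Finset.mem_sigma.1 hi).1
    omega
  rw [minor_ADK i.1 hk, mul_zero]

end
end

section
/- Let n ≥ 2 and suppose T is a smooth function on J² of the minor-polynomial form T = Σ_{k=0}^{n} (1/(k!)²) T_{μ₁…μ_k;ν₁…ν_k} ψ^{μ₁…μ_k;ν₁…ν_k}, and suppose T is Poincaré invariant: T∘φ̇_{L,a} = T for all L ∈ L↑₊ and a ∈ ℝ^n. Then T admits a minor-polynomial representation whose coefficient tensors T_{μ₁…μ_k;ν₁…ν_k} are independent of x (∂T_{…}/∂x^λ = 0 for all λ) and Lorentz-equivariant: T_{μ₁…μ_k;ν₁…ν_k}(ψ, L·ψ_·) = L_{μ₁}^{ρ₁}⋯L_{μ_k}^{ρ_k} L_{ν₁}^{σ₁}⋯L_{ν_k}^{σ_k} T_{ρ₁…ρ_k;σ₁…σ_k}(ψ, ψ_·) for all L ∈ L↑₊, where (L·ψ_·)_μ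 := L_μ^ρ ψ_ρ. -/
open scoped BigOperators

noncomputable section

lemma lc_eq_det {n : ℕ} (ρ : Fin n → Fin n) :
    lc ρ = ((1 : Matrix (Fin n) (Fin n) ℝ).submatrix id ρ).det := by
  unfold lc
  split_ifs with h
  · have := Matrix.det_permute' (Equiv.ofBijective ρ h) (1 : Matrix (Fin n) (Fin n) ℝ)
    simpa using this.symm
  · have h2 : ¬ Function.Injective ρ := fun hi => h (Finite.injective_iff_bijective.mp hi)
    simp only [Function.Injective, not_forall] at h2
    obtain ⟨i, j, hij, hne⟩ := h2
    symm
    apply Matrix.det_zero_of_column_eq hne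
    intro r
    exact congrArg (fun t => (1 : Matrix (Fin n) (Fin n) ℝ) r t) hij

lemma lc_perm {n : ℕ} (σ : Equiv.Perm (Fin n)) :
    lc (fun i => σ i) = ((Equiv.Perm.sign σ : ℤ) : ℝ) := by
  unfold lc
  rw [dif_pos σ.bijective]
  congr 3
  ext; simp

lemma sum_lc {n : ℕ} (L : Fin n → Fin n → ℝ) (ρ : Fin n → Fin n) :
    ∑ μ : Fin n → Fin n, lc μ * ∏ i, L (μ i) (ρ i) = (Matrix.of L).det * lc ρ := by
  have h1 : (Matrix.of L).det * lc ρ = ((Matrix.of L).submatrix id ρ).det := by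
    rw [lc_eq_det, ← Matrix.det_mul]
    congr 1
    ext i j
    simp [Matrix.mul_apply, Matrix.one_apply]
  rw [h1, Matrix.det_apply']
  symm
  apply Finset.sum_of_injOn (fun σ : Equiv.Perm (Fin n) => (σ : Fin n → Fin n))
  · intro a _ b _ h
    exact DFunLike.coe_injective h
  · intro a _; simp
  · intro μ _ hμ
    have : ¬ Function.Bijective μ := by
      intro hb
      apply hμ
      exact ⟨Equiv.ofBijective μ hb, by simp, rfl⟩
    rw [lc, dif_neg this, zero_mul]
  · intro σ _
    rw [show lc (⇑σ) = _ from lc_perm σ]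
    simp

lemma sum_lc_append {n k m : ℕ} (h : k + m = n) (L : Fin n → Fin n → ℝ)
    (ρ : Fin k → Fin n) (r : Fin m → Fin n) :
    ∑ μ : Fin k → Fin n, ∑ a : Fin m → Fin n,
      (∏ i, L (μ i) (ρ i)) * lc (Fin.append μ a ∘ Fin.cast h.symm) * (∏ i, L (a i) (r i)) =
    (Matrix.of L).det * lc (Fin.append ρ r ∘ Fin.cast h.symm) := by
  subst h
  rw [← sum_lc, ← Fintype.sum_prod_type', ← (Fin.appendEquiv k m).sum_comp]
  apply Finset.sum_congr rfl
  rintro ⟨μ, a⟩ _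
  simp only [Fin.appendEquiv, Equiv.coe_fn_mk, Fin.cast_refl, Function.comp_id, Fin.prod_univ_add,
    Fin.append_left, Fin.append_right, Function.comp_apply, id]
  ring

lemma six_sums {M A : Type*} [Fintype M] [Fintype A] (X Y : M → ℝ) (F : M → A → ℝ)
    (P Q : A → A → ℝ) (f d : ℝ) (ρ σ : M)
    (hX : ∀ r, ∑ μ, ∑ a, X μ * F μ a * P a r = d * F ρ r)
    (hY : ∀ r, ∑ μ, ∑ a, Y μ * F μ a * P a r = d * F σ r) :
    ∑ μ, ∑ ν, X μ * Y ν * (f * ∑ a, ∑ b, F μ a * F ν b * ∑ r, ∑ s, P a r * P b s * Q r s) =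
      d ^ 2 * (f * ∑ r, ∑ s, F ρ r * F σ s * Q r s) := by
  have e : d ^ 2 * (f * ∑ r, ∑ s, F ρ r * F σ s * Q r s) =
      f * ∑ r, ∑ s, (∑ μ, ∑ a, X μ * F μ a * P a r) * (∑ ν, ∑ b, Y ν * F ν b * P b s) * Q r s := by
    simp only [hX, hY, Finset.mul_sum]
    refine Finset.sum_congr rfl fun r _ => Finset.sum_congr rfl fun s _ => by ring
  rw [e]
  simp only [← Fintype.sum_prod_type']
  simp only [Finset.mul_sum, Finset.sum_mul]
  simp only [← Fintype.sum_prod_type']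
  refine Fintype.sum_equiv
    ⟨fun z => (z.2.2, ((z.1.2, z.2.1.2), (z.1.1, z.2.1.1))),
      fun w => ((w.2.2.1, w.2.1.1), ((w.2.2.2, w.2.1.2), w.1)),
      fun _ => rfl, fun _ => rfl⟩ _ _ ?_
  rintro ⟨⟨μ, ν⟩, ⟨a, b⟩, ⟨r, s⟩⟩
  simp only [Equiv.coe_fn_mk]
  ring

/-- `L q Lᵀ`. -/
def conjM {n : ℕ} (L q : Fin n → Fin n → ℝ) : Fin n → Fin n → ℝ :=
  fun μ ν => ∑ ρ, ∑ σ, L μ ρ * L ν σ * q ρ σ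

lemma conjM_eq {n : ℕ} (L q : Fin n → Fin n → ℝ) :
    conjM L q = fun i j => (Matrix.of L * Matrix.of q * (Matrix.of L).transpose) i j := by
  ext i j
  simp only [conjM, Matrix.mul_apply, Matrix.of_apply, Matrix.transpose_apply, Finset.sum_mul]
  rw [Finset.sum_comm]
  refine Finset.sum_congr rfl fun r _ => Finset.sum_congr rfl fun s _ => by ring

lemma symmM_conjM {n : ℕ} (L q : Fin n → Fin n → ℝ) :
    symmM (conjM L q) = conjM L (symmM q) := by
  ext i j
  have : conjM L q j i = ∑ ρ, ∑ σ, L i ρ * L j σ * q σ ρ := by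
    unfold conjM
    rw [Finset.sum_comm]
    refine Finset.sum_congr rfl fun r _ => Finset.sum_congr rfl fun s _ => by ring
  rw [symmM, this]
  simp only [conjM, symmM, ← Finset.sum_add_distrib, Finset.sum_div]
  refine Finset.sum_congr rfl fun r _ => Finset.sum_congr rfl fun s _ => by ring

lemma symmM_symmM {n : ℕ} (q : Fin n → Fin n → ℝ) : symmM (symmM q) = symmM q := by
  ext i j; simp only [symmM]; ring

lemma conjM_surj {n : ℕ} (L q : Fin n → Fin n → ℝ) (hL : (Matrix.of L).det = 1) :
    ∃ q', conjM L q' = q := by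
  have hu : IsUnit (Matrix.of L).det := by rw [hL]; exact isUnit_one
  have hu' : IsUnit (Matrix.of L).transpose.det := by rw [Matrix.det_transpose]; exact hu
  refine ⟨fun i j => ((Matrix.of L)⁻¹ * Matrix.of q * (Matrix.of L).transpose⁻¹) i j, ?_⟩
  rw [conjM_eq]
  ext i j
  change (Matrix.of L * ((Matrix.of L)⁻¹ * Matrix.of q * (Matrix.of L).transpose⁻¹) *
    (Matrix.of L).transpose) i j = q i j
  rw [← Matrix.mul_assoc, ← Matrix.mul_assoc, Matrix.mul_nonsing_inv _ hu, Matrix.one_mul,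
    Matrix.mul_assoc, Matrix.nonsing_inv_mul _ hu', Matrix.mul_one]
  rfl

lemma minor_conj {n k : ℕ} (L q : Fin n → Fin n → ℝ) (ρ σ : Fin k → Fin n) :
    ∑ μ : Fin k → Fin n, ∑ ν : Fin k → Fin n,
      (∏ i, L (μ i) (ρ i)) * (∏ i, L (ν i) (σ i)) * minorP k μ ν (conjM L q) =
    (Matrix.of L).det ^ 2 * minorP k ρ σ q := by
  unfold minorP
  split_ifs with h
  · have hp : ∀ a b : Fin (n - k) → Fin n, ∏ i, conjM L q (a i) (b i) =
        ∑ r : Fin (n - k) → Fin n, ∑ s : Fin (n - k) → Fin n,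
          (∏ i, L (a i) (r i)) * (∏ i, L (b i) (s i)) * ∏ i, q (r i) (s i) := by
      intro a b
      unfold conjM
      rw [Fintype.prod_sum]
      refine Finset.sum_congr rfl fun r _ => ?_
      rw [Fintype.prod_sum]
      refine Finset.sum_congr rfl fun s _ => ?_
      simp only [Finset.prod_mul_distrib]
    simp only [hp]
    exact six_sums (fun μ : Fin k → Fin n => ∏ i, L (μ i) (ρ i)) (fun ν => ∏ i, L (ν i) (σ i))
      (fun μ a => lc (Fin.append μ a ∘ Fin.cast h.symm))
      (fun a r => ∏ i, L (a i) (r i)) (fun r s => ∏ i, q (r i) (s i)) _ _ ρ σ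
      (fun r => sum_lc_append h L ρ r) (fun r => sum_lc_append h L σ r)
  · simp

/-- Tensor coefficients. -/
abbrev Idx (n : ℕ) : Type := (k : Fin (n + 1)) × ((Fin k → Fin n) × (Fin k → Fin n))

abbrev TE (n : ℕ) : Type := EuclideanSpace ℝ (Idx n)

/-- Polynomial represented by a coefficient tensor. -/
def polyP {n : ℕ} (u : TE n) (q : Fin n → Fin n → ℝ) : ℝ :=
  ∑ k : Fin (n + 1), (((k : ℕ).factorial : ℝ)⁻¹) ^ 2 *
      ∑ μ : Fin k → Fin n, ∑ ν : Fin k → Fin n, u ⟨k, μ, ν⟩ * minorP k μ ν (symmM q)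

/-- antisymmetric tensors -/
def subA (n : ℕ) : Submodule ℝ (TE n) where
  carrier := {u | (∀ (k : Fin (n + 1)) (μ ν : Fin k → Fin n) (σ : Equiv.Perm (Fin k)),
      u ⟨k, μ ∘ σ, ν⟩ = ((Equiv.Perm.sign σ : ℤ) : ℝ) * u ⟨k, μ, ν⟩) ∧
    (∀ (k : Fin (n + 1)) (μ ν : Fin k → Fin n) (σ : Equiv.Perm (Fin k)),
      u ⟨k, μ, ν ∘ σ⟩ = ((Equiv.Perm.sign σ : ℤ) : ℝ) * u ⟨k, μ, ν⟩) ∧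
    (∀ (k : Fin (n + 1)) (μ ν : Fin k → Fin n), u ⟨k, ν, μ⟩ = u ⟨k, μ, ν⟩)}
  add_mem' := by
    rintro u v ⟨h1, h2, h3⟩ ⟨g1, g2, g3⟩
    refine ⟨?_, ?_, ?_⟩
    · intro k μ ν σ; simp only [PiLp.add_apply, h1, g1]; ring
    · intro k μ ν σ; simp only [PiLp.add_apply, h2, g2]; ring
    · intro k μ ν; simp only [PiLp.add_apply]; rw [h3, g3]
  zero_mem' := by simp
  smul_mem' := by
    rintro c u ⟨h1, h2, h3⟩
    refine ⟨?_, ?_, ?_⟩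
    · intro k μ ν σ; simp only [PiLp.smul_apply, h1, smul_eq_mul]; ring
    · intro k μ ν σ; simp only [PiLp.smul_apply, h2, smul_eq_mul]; ring
    · intro k μ ν; simp only [PiLp.smul_apply]; rw [h3]

lemma polyP_add {n : ℕ} (u v : TE n) (q : Fin n → Fin n → ℝ) :
    polyP (u + v) q = polyP u q + polyP v q := by
  simp only [polyP, PiLp.add_apply, add_mul, Finset.sum_add_distrib, mul_add]

lemma polyP_smul {n : ℕ} (c : ℝ) (u : TE n) (q : Fin n → Fin n → ℝ) :
    polyP (c • u) q = c * polyP u q := by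
  simp only [polyP, PiLp.smul_apply, Finset.mul_sum, smul_eq_mul]
  refine Finset.sum_congr rfl fun r _ => Finset.sum_congr rfl fun s _ =>
    Finset.sum_congr rfl fun t _ => by ring

lemma polyP_sub {n : ℕ} (u v : TE n) (q : Fin n → Fin n → ℝ) :
    polyP (u - v) q = polyP u q - polyP v q := by
  have := polyP_add (u - v) v q
  rw [sub_add_cancel] at this
  linarith

/-- antisymmetric tensors representing zero -/
def subN (n : ℕ) : Submodule ℝ (TE n) where
  carrier := {u | u ∈ subA n ∧ ∀ q, polyP u q = 0}
  add_mem' := by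
    rintro u v ⟨h1, h2⟩ ⟨g1, g2⟩
    exact ⟨(subA n).add_mem h1 g1, fun q => by rw [polyP_add, h2, g2, add_zero]⟩
  zero_mem' := ⟨(subA n).zero_mem, by simp [polyP]⟩
  smul_mem' := by
    rintro c u ⟨h1, h2⟩
    exact ⟨(subA n).smul_mem c h1, fun q => by rw [polyP_smul, h2, mul_zero]⟩

/-- The tensor action. -/
def rho {n : ℕ} (L : Fin n → Fin n → ℝ) (u : TE n) : TE n :=
  WithLp.toLp 2 fun z => ∑ ρ' : Fin z.1 → Fin n, ∑ σ' : Fin z.1 → Fin n,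
    (∏ i, L (z.2.1 i) (ρ' i)) * (∏ i, L (z.2.2 i) (σ' i)) * u ⟨z.1, ρ', σ'⟩

lemma rho_apply {n : ℕ} (L : Fin n → Fin n → ℝ) (u : TE n) (k : Fin (n + 1))
    (μ ν : Fin k → Fin n) : rho L u ⟨k, μ, ν⟩ =
    ∑ ρ' : Fin k → Fin n, ∑ σ' : Fin k → Fin n,
    (∏ i, L (μ i) (ρ' i)) * (∏ i, L (ν i) (σ' i)) * u ⟨k, ρ', σ'⟩ := rfl

lemma rho_adj {n : ℕ} (L : Fin n → Fin n → ℝ) (u v : TE n) :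
    inner ℝ u (rho L v) = inner ℝ (rho (fun i j => L j i) u) v := by
  simp only [PiLp.inner_apply, RCLike.inner_apply, conj_trivial, Fintype.sum_sigma,
    Fintype.sum_prod_type, rho_apply]
  refine Finset.sum_congr rfl fun k _ => ?_
  simp only [← Fintype.sum_prod_type']
  simp only [Finset.mul_sum, Finset.sum_mul]
  rw [Finset.sum_comm]
  refine Finset.sum_congr rfl fun r _ => Finset.sum_congr rfl fun s _ => by ring

lemma prod_comp_perm {n k : ℕ} (L : Fin n → Fin n → ℝ) (μ ρ : Fin k → Fin n)
    (σ : Equiv.Perm (Fin k)) :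
    ∏ i, L ((μ ∘ σ) i) ((ρ ∘ σ) i) = ∏ i, L (μ i) (ρ i) :=
  Equiv.prod_comp σ (fun i => L (μ i) (ρ i))

lemma rho_mem_A {n : ℕ} (L : Fin n → Fin n → ℝ) {u : TE n} (hu : u ∈ subA n) :
    rho L u ∈ subA n := by
  obtain ⟨h1, h2, h3⟩ := hu
  refine ⟨?_, ?_, ?_⟩
  · intro k μ ν σ
    simp only [rho_apply]
    rw [← (Equiv.arrowCongr σ.symm (Equiv.refl (Fin n))).sum_comp]
    have e : ∀ ρ : Fin k → Fin n,
      (Equiv.arrowCongr σ.symm (Equiv.refl (Fin n))) ρ = ρ ∘ σ := fun ρ => by ext; simp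
    simp only [e, prod_comp_perm, h1, Finset.mul_sum]
    refine Finset.sum_congr rfl fun r _ => Finset.sum_congr rfl fun s _ => by ring
  · intro k μ ν σ
    simp only [rho_apply, Finset.mul_sum]
    refine Finset.sum_congr rfl fun r _ => ?_
    rw [← (Equiv.arrowCongr σ.symm (Equiv.refl (Fin n))).sum_comp]
    have e : ∀ ρ : Fin k → Fin n,
      (Equiv.arrowCongr σ.symm (Equiv.refl (Fin n))) ρ = ρ ∘ σ := fun ρ => by ext; simp
    simp only [e, prod_comp_perm, h2]
    refine Finset.sum_congr rfl fun s _ => by ring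
  · intro k μ ν
    simp only [rho_apply]
    rw [Finset.sum_comm]
    refine Finset.sum_congr rfl fun r _ => Finset.sum_congr rfl fun s _ => ?_
    rw [h3]; ring

lemma polyP_rho {n : ℕ} (L : Fin n → Fin n → ℝ) (hL : (Matrix.of L).det = 1) (u : TE n)
    (q : Fin n → Fin n → ℝ) : polyP (rho L u) (conjM L q) = polyP u q := by
  unfold polyP
  refine Finset.sum_congr rfl fun k _ => ?_
  congr 1
  rw [symmM_conjM]
  have hm := fun ρ σ : Fin k → Fin n => minor_conj L (symmM q) ρ σ
  simp only [hL, one_pow, one_mul] at hm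
  simp only [← hm, rho_apply]
  simp only [← Fintype.sum_prod_type']
  simp only [Finset.mul_sum, Finset.sum_mul]
  rw [Finset.sum_comm]
  refine Finset.sum_congr rfl fun r _ => Finset.sum_congr rfl fun s _ => by ring

lemma rho_mem_N {n : ℕ} (L : Fin n → Fin n → ℝ) (hL : (Matrix.of L).det = 1) {u : TE n}
    (hu : u ∈ subN n) : rho L u ∈ subN n := by
  refine ⟨rho_mem_A L hu.1, fun q => ?_⟩
  obtain ⟨q', rfl⟩ := conjM_surj L q hL
  rw [polyP_rho L hL, hu.2]

lemma rho_mem_orth {n : ℕ} (L : Fin n → Fin n → ℝ) (hL : (Matrix.of L).det = 1) {v : TE n}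
    (hv : v ∈ (subN n)ᗮ) : rho L v ∈ (subN n)ᗮ := by
  rw [Submodule.mem_orthogonal] at hv ⊢
  intro u hu
  rw [rho_adj]
  refine hv _ (rho_mem_N _ ?_ hu)
  rw [← Matrix.det_transpose] at hL
  exact hL

lemma uniq_rep {n : ℕ} {u v : TE n} (hu : u ∈ subA n) (hu' : u ∈ (subN n)ᗮ)
    (hv : v ∈ subA n) (hv' : v ∈ (subN n)ᗮ) (h : ∀ q, polyP u q = polyP v q) : u = v := by
  have h1 : u - v ∈ subN n :=
    ⟨(subA n).sub_mem hu hv, fun q => by rw [polyP_sub, h, sub_self]⟩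
  have h2 : u - v ∈ (subN n)ᗮ := Submodule.sub_mem _ hu' hv'
  have := (Submodule.mem_orthogonal _ _).1 h2 _ h1
  exact sub_eq_zero.1 (inner_self_eq_zero.1 this)

/-- Canonical coefficients. -/
def canon {n : ℕ} : TE n →L[ℝ] TE n := (subN n)ᗮ.starProjection

lemma canon_orth {n : ℕ} (u : TE n) : canon u ∈ (subN n)ᗮ :=
  Submodule.starProjection_apply_mem _ _

lemma canon_diff {n : ℕ} (u : TE n) : u - canon u ∈ subN n := by
  have : u - canon u ∈ (subN n)ᗮᗮ := Submodule.sub_starProjection_mem_orthogonal u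
  rwa [Submodule.orthogonal_orthogonal] at this

lemma canon_A {n : ℕ} {u : TE n} (hu : u ∈ subA n) : canon u ∈ subA n := by
  have := (subA n).sub_mem hu (canon_diff u).1
  simpa using this

lemma canon_poly {n : ℕ} (u : TE n) (q : Fin n → Fin n → ℝ) : polyP (canon u) q = polyP u q := by
  have := (canon_diff u).2 q
  rw [polyP_sub] at this
  linarith

theorem poincare_invariant_coefficients {n : ℕ} (hn : 2 ≤ n) (T : J2 n → ℝ)
    (hT : ContDiff ℝ (⊤ : ℕ∞) T) (hsym : SymmDep T) (hmp : MinorPolyForm T)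
    (hinv : ∀ (L : Fin n → Fin n → ℝ) (a : Fin n → ℝ), IsLorentz L →
      ∀ z : J2 n, T (pact L a z) = T z) :
    ∃ c : (k : ℕ) → (Fin k → Fin n) → (Fin k → Fin n) → ℝ → (Fin n → ℝ) → ℝ,
      (∀ k (μ ν : Fin k → Fin n),
        ContDiff ℝ (⊤ : ℕ∞) (fun w : ℝ × (Fin n → ℝ) => c k μ ν w.1 w.2)) ∧
      (∀ k (μ ν : Fin k → Fin n) (σ : Equiv.Perm (Fin k)) ψ pv,
        c k (μ ∘ σ) ν ψ pv = ((Equiv.Perm.sign σ : ℤ) : ℝ) * c k μ ν ψ pv) ∧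
      (∀ k (μ ν : Fin k → Fin n) (σ : Equiv.Perm (Fin k)) ψ pv,
        c k μ (ν ∘ σ) ψ pv = ((Equiv.Perm.sign σ : ℤ) : ℝ) * c k μ ν ψ pv) ∧
      (∀ k (μ ν : Fin k → Fin n) ψ pv, c k ν μ ψ pv = c k μ ν ψ pv) ∧
      (∀ x ψ pv q, T (x, ψ, pv, q) =
        ∑ k ∈ Finset.range (n + 1), ((k.factorial : ℝ)⁻¹) ^ 2 *
          ∑ μ : Fin k → Fin n, ∑ ν : Fin k → Fin n,
            c k μ ν ψ pv * minorP k μ ν (symmM q)) ∧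
      (∀ k (μ ν : Fin k → Fin n) (ψ : ℝ) (pv : Fin n → ℝ)
          (L : Fin n → Fin n → ℝ), IsLorentz L →
        c k μ ν ψ (fun ρ => ∑ σ, L ρ σ * pv σ) =
          ∑ ρ' : Fin k → Fin n, ∑ σ' : Fin k → Fin n,
            (∏ i, L (μ i) (ρ' i)) * (∏ i, L (ν i) (σ' i)) * c k ρ' σ' ψ pv) := by
  obtain ⟨c, ⟨hc1, hc2, hc3, hc4⟩, hrep⟩ := hmp
  let u : ℝ × (Fin n → ℝ) → TE n := fun w =>
    WithLp.toLp 2 fun z => c z.1 z.2.1 z.2.2 (0, w.1, w.2)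
  have huA : ∀ w, u w ∈ subA n := fun w =>
    ⟨fun k μ ν σ => hc2 k μ ν σ _, fun k μ ν σ => hc3 k μ ν σ _, fun k μ ν => hc4 k μ ν _⟩
  have hus : ContDiff ℝ (⊤ : ℕ∞) u := by
    rw [contDiff_euclidean]
    intro z
    exact (hc1 z.1 z.2.1 z.2.2).comp (contDiff_const.prodMk (contDiff_fst.prodMk contDiff_snd))
  have hcs : ContDiff ℝ (⊤ : ℕ∞) (fun w => canon (u w)) := canon.contDiff.comp hus
  have hT0 : ∀ ψ pv q, T (0, ψ, pv, q) = polyP (canon (u (ψ, pv))) q := by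
    intro ψ pv q
    rw [canon_poly, hrep, Finset.sum_range]
    rfl
  have hone : IsLorentz (fun i j : Fin n => (1 : Matrix (Fin n) (Fin n) ℝ) i j) := by
    refine ⟨?_, ?_, ?_⟩
    · intro i j
      simp [Matrix.one_apply]
    · exact Matrix.det_one
    · intro h; simp
  have hTx : ∀ x ψ pv q, T (x, ψ, pv, q) = T (0, ψ, pv, q) := by
    intro x ψ pv q
    rw [← hinv _ x hone (0, ψ, pv, q)]
    congr 1
    simp [pact, Matrix.one_apply]
  have hLor : ∀ ψ pv (L : Fin n → Fin n → ℝ), IsLorentz L →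
      canon (u (ψ, fun ρ => ∑ σ, L ρ σ * pv σ)) = rho L (canon (u (ψ, pv))) := by
    intro ψ pv L hL
    refine uniq_rep (canon_A (huA _)) (canon_orth _) (rho_mem_A L (canon_A (huA _)))
      (rho_mem_orth L hL.2.1 (canon_orth _)) fun q => ?_
    obtain ⟨q', rfl⟩ := conjM_surj L q hL.2.1
    rw [polyP_rho L hL.2.1, ← hT0, ← hT0, ← hinv L 0 hL (0, ψ, pv, q')]
    congr 1
    simp only [pact, Pi.zero_apply, mul_zero, Finset.sum_const_zero, add_zero]
    rfl
  refine ⟨fun k μ ν ψ pv => if h : k < n + 1 then canon (u (ψ, pv)) ⟨⟨k, h⟩, μ, ν⟩ else 0,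
    ?_, ?_, ?_, ?_, ?_, ?_⟩
  · intro k μ ν
    by_cases h : k < n + 1
    · simp only [h, dif_pos]
      exact (contDiff_euclidean.1 hcs) _
    · simp only [h, dif_neg, not_false_eq_true]
      exact contDiff_const
  · intro k μ ν σ ψ pv
    dsimp only
    split_ifs with h
    · exact (canon_A (huA (ψ, pv))).1 ⟨k, h⟩ μ ν σ
    · simp
  · intro k μ ν σ ψ pv
    dsimp only
    split_ifs with h
    · exact (canon_A (huA (ψ, pv))).2.1 ⟨k, h⟩ μ ν σ
    · simp
  · intro k μ ν ψ pv
    dsimp only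
    split_ifs with h
    · exact (canon_A (huA (ψ, pv))).2.2 ⟨k, h⟩ μ ν
    · rfl
  · intro x ψ pv q
    rw [hTx, hT0, Finset.sum_range]
    unfold polyP
    refine Finset.sum_congr rfl fun k _ => ?_
    simp only [k.2, dif_pos, Fin.eta]
  · intro k μ ν ψ pv L hL
    by_cases h : k < n + 1
    · simp only [h, dif_pos]
      rw [hLor ψ pv L hL]
      rfl
    · simp [h]

end
end
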